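/- Let X have the free Poisson distribution with rate λ > 1 and jump size α = 1 in a tracial *-probability space. For m ≥ 1 and nonnegative integers i_1, ..., i_m, consider the joint cumulant R_{i_1+⋯+i_m+m}(X^{-1}, X,...,X (i_1 times), X^{-1}, X,...,X (i_2 times), ..., X^{-1}, X,...,X (i_m times)). If some i_k > 1 (i.e., two X's appear adjacently), this cumulant equals 0; if all i_k ≤ 1, it equals (−1)^{i_1+⋯+i_m} · R_m(X^{-1}), where R_m(X^{-1}) = C_{m-1}/(λ−1)^{2m−1}. -/

import Mathlib

open scoped Classical
open Finset

noncomputable section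

namespace FreeProbLukacs

variable {A : Type*}

/-- Ordered (non-commutative) product of a tuple. -/
def tprod [Monoid A] {n : ℕ} (X : Fin n → A) : A := (List.ofFn X).prod

/-- `P` is a partition of `Fin n`: a finset of nonempty blocks, each point in a unique block. -/
def IsPartition {n : ℕ} (P : Finset (Finset (Fin n))) : Prop :=
  (∀ B ∈ P, B.Nonempty) ∧ ∀ i : Fin n, ∃! B, B ∈ P ∧ i ∈ B

/-- `P` is non-crossing: there are no `a < b < c < d` with `a, c` in one block and
`b, d` in a different block. -/
def IsNonCrossing {n : ℕ} (P : Finset (Finset (Fin n))) : Prop :=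
  ∀ B₁ ∈ P, ∀ B₂ ∈ P, ∀ a ∈ B₁, ∀ b ∈ B₂, ∀ c ∈ B₁, ∀ d ∈ B₂,
    a < b → b < c → c < d → B₁ = B₂

/-- The finset of all non-crossing partitions of `Fin n`. -/
def NC (n : ℕ) : Finset (Finset (Finset (Fin n))) :=
  univ.filter fun P => IsPartition P ∧ IsNonCrossing P

/-- The cumulant functional `R` applied to the entries of `X` lying in a block `B`,
taken in increasing order of position. -/
def blockCum (R : ∀ n, (Fin n → A) → ℂ) {n : ℕ} (X : Fin n → A) (B : Finset (Fin n)) : ℂ :=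
  R B.card fun j => X ((B.sort (· ≤ ·)).get (Fin.cast (Finset.length_sort (· ≤ ·)).symm j))

/-- Product of block cumulants over the blocks of a partition. -/
def partCum (R : ∀ n, (Fin n → A) → ℂ) {n : ℕ} (X : Fin n → A)
    (P : Finset (Finset (Fin n))) : ℂ :=
  ∏ B ∈ P, blockCum R X B

/-- The moment–cumulant formula: `R` is the family of free cumulants of `φ`. -/
def MomentCumulant [Monoid A] (φ : A → ℂ) (R : ∀ n, (Fin n → A) → ℂ) : Prop :=
  ∀ (n : ℕ) (X : Fin n → A), φ (tprod X) = ∑ P ∈ NC n, partCum R X P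

/-- Density of the absolutely continuous part of the Marchenko–Pastur law. -/
def freePoissonDensity (l a x : ℝ) : ℝ :=
  Real.sqrt (4 * l * a ^ 2 - (x - a * (1 + l)) ^ 2) / (2 * Real.pi * a * x)

/-- The free Poisson (Marchenko–Pastur) distribution with rate `l` and jump size `a`. -/
def freePoissonMeasure (l a : ℝ) : MeasureTheory.Measure ℝ :=
  ENNReal.ofReal (max 0 (1 - l)) • MeasureTheory.Measure.dirac 0 +
    MeasureTheory.volume.withDensity fun x => ENNReal.ofReal (freePoissonDensity l a x)

/-- `X` has distribution `μ` in the sense of moments. -/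
def HasMoments [Monoid A] (φ : A → ℂ) (X : A) (μ : MeasureTheory.Measure ℝ) : Prop :=
  ∀ r : ℕ, φ (X ^ r) = ((∫ t, t ^ r ∂μ : ℝ) : ℂ)

/-- `φ` is a state: unital and positive. -/
def IsState [Ring A] [StarRing A] [Module ℂ A] (φ : A →ₗ[ℂ] ℂ) : Prop :=
  φ 1 = 1 ∧ ∀ a : A, ∃ r : ℝ, 0 ≤ r ∧ φ (star a * a) = (r : ℂ)

/-- `φ` is faithful. -/
def Faithful [Ring A] [StarRing A] [Module ℂ A] (φ : A →ₗ[ℂ] ℂ) : Prop :=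
  ∀ a : A, φ (star a * a) = 0 → a = 0

/-- `φ` is tracial. -/
def Tracial [Ring A] [Module ℂ A] (φ : A →ₗ[ℂ] ℂ) : Prop :=
  ∀ a b : A, φ (a * b) = φ (b * a)

/-- All mixed cumulants with entries from `S` and from `T` vanish. -/
def MixedVanish (R : ∀ n, (Fin n → A) → ℂ) (S T : Set A) : Prop :=
  ∀ (n : ℕ) (f : Fin n → A), (∀ i, f i ∈ S ∪ T) → (∃ i, f i ∈ S) → (∃ j, f j ∈ T) →
    R n f = 0

/-- Two elements are free: all their mixed free cumulants vanish. -/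
def FreeElems (R : ∀ n, (Fin n → A) → ℂ) (x y : A) : Prop :=
  MixedVanish R {x} {y}

/-- Interleaving of a partition `P` (placed at positions `1,2,…,n`, i.e. evens)
and `Q` (placed at positions `1̄,…,n̄`, i.e. odds) inside `Fin (2 * n)`. -/
def interleave {n : ℕ} (P Q : Finset (Finset (Fin n))) : Finset (Finset (Fin (2 * n))) :=
  P.image (fun B => B.image fun i => (⟨2 * i.1, by have := i.isLt; omega⟩ : Fin (2 * n)))
    ∪ Q.image (fun B => B.image fun i => (⟨2 * i.1 + 1, by have := i.isLt; omega⟩ : Fin (2 * n)))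

/-- `Q` refines ... : every block of `P` is contained in a block of `Q`. -/
def Refines {n : ℕ} (P Q : Finset (Finset (Fin n))) : Prop :=
  ∀ B ∈ P, ∃ C ∈ Q, B ⊆ C

/-- `Q` is the Kreweras complement of `P`: the largest partition whose interleaving
with `P` is non-crossing. -/
def IsKrewerasComplement {n : ℕ} (P Q : Finset (Finset (Fin n))) : Prop :=
  IsPartition Q ∧ IsNonCrossing (interleave P Q) ∧
    ∀ Q', IsPartition Q' → IsNonCrossing (interleave P Q') → Refines Q' Q

end FreeProbLukacs
namespace FreeProbLukacs

/-- Sum of `F u v` over all splittings `w = u ++ v`. -/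
def splitSum {α : Type*} : (List α → List α → ℂ) → List α → ℂ
  | F, [] => F [] []
  | F, y :: w => F [] (y :: w) + splitSum (fun u v => F (y :: u) v) w

theorem splitSum_congr {α : Type*} {F G : List α → List α → ℂ} {w : List α}
    (h : ∀ u v, u ++ v = w → F u v = G u v) : splitSum F w = splitSum G w := by
  induction w generalizing F G with
  | nil => exact h _ _ rfl
  | cons y w ih =>
    simp only [splitSum]
    rw [h [] (y :: w) rfl, ih fun u v huv => h (y :: u) v (by simp [huv])]

theorem splitSum_const_mul {α : Type*} (c : ℂ) (F : List α → List α → ℂ) (w : List α) :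
    splitSum (fun u v => c * F u v) w = c * splitSum F w := by
  induction w generalizing F with
  | nil => rfl
  | cons y w ih => simp only [splitSum, ih, mul_add]

theorem splitSum_zero {α : Type*} (w : List α) : splitSum (fun _ _ => 0) w = 0 := by
  induction w with
  | nil => rfl
  | cons y w ih => simp [splitSum, ih]

theorem splitSum_concat {α : Type*} (F : List α → List α → ℂ) (w : List α) (y : α) :
    splitSum F (w ++ [y]) = splitSum (fun u v => F u (v ++ [y])) w + F (w ++ [y]) [] := by
  induction w generalizing F with
  | nil => simp [splitSum]
  | cons z w ih => simp [splitSum, ih, add_assoc]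

theorem splitSum_map {α β : Type*} (g : α → β) (F : List β → List β → ℂ) (w : List α) :
    splitSum F (w.map g) = splitSum (fun u v => F (u.map g) (v.map g)) w := by
  induction w generalizing F with
  | nil => rfl
  | cons y w ih => simp [splitSum, ih]

theorem splitSum_replicate {α : Type*} (y : α) (F : List α → List α → ℂ) (k : ℕ) :
    splitSum F (List.replicate k y) = ∑ i ∈ Finset.range (k + 1),
      F (List.replicate i y) (List.replicate (k - i) y) := by
  induction k generalizing F with
  | zero => simp [splitSum]
  | succ k ih =>
    rw [List.replicate_succ, splitSum, ih, Finset.sum_range_succ' _ (k + 1)]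
    simp [List.replicate_succ, add_comm]

/-- Sum over all ways to extract a subword `V` from `w`: the subword is weighted by `K`, the gap
preceding its first letter by `Φ`, and the later gaps by `φ`. -/
def gapSum {A : Type*} (φ : List A → ℂ) : List A → (List A → ℂ) → (List A → ℂ) → ℂ
  | [], K, Φ => K [] * Φ []
  | y :: w, K, Φ => gapSum φ w K (fun u => Φ (y :: u)) + Φ [] * gapSum φ w (fun u => K (y :: u)) φ

section GapSum

variable {A : Type*} (φ : List A → ℂ)

theorem gapSum_add_left (w : List A) (K L Φ : List A → ℂ) :
    gapSum φ w (fun u => K u + L u) Φ = gapSum φ w K Φ + gapSum φ w L Φ := by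
  induction w generalizing K L Φ with
  | nil => simp [gapSum, add_mul]
  | cons y w ih => simp only [gapSum, ih]; ring

theorem gapSum_add_right (w : List A) (K Φ Ψ : List A → ℂ) :
    gapSum φ w K (fun u => Φ u + Ψ u) = gapSum φ w K Φ + gapSum φ w K Ψ := by
  induction w generalizing K Φ Ψ with
  | nil => simp [gapSum, mul_add]
  | cons y w ih => simp only [gapSum, ih]; ring

theorem gapSum_mul_left (w : List A) (c : ℂ) (K Φ : List A → ℂ) :
    gapSum φ w (fun u => c * K u) Φ = c * gapSum φ w K Φ := by
  induction w generalizing K Φ with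
  | nil => simp [gapSum, mul_assoc]
  | cons y w ih => simp only [gapSum, ih]; ring

theorem gapSum_mul_right (w : List A) (c : ℂ) (K Φ : List A → ℂ) :
    gapSum φ w K (fun u => c * Φ u) = c * gapSum φ w K Φ := by
  induction w generalizing K Φ with
  | nil => simp [gapSum]; ring
  | cons y w ih => simp only [gapSum, ih]; ring

/-- Nested extraction of subwords amounts to one extraction with the split weight. -/
theorem gapSum_gapSum (w : List A) (K L Φ : List A → ℂ) :
    gapSum φ w K (fun u => gapSum φ u L Φ) =
      gapSum φ w (splitSum fun u v => L u * K v) Φ := by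
  induction w generalizing K L Φ with
  | nil => simp [gapSum, splitSum]; ring
  | cons y w ih =>
    simp only [gapSum, splitSum, gapSum_add_right, gapSum_mul_right, gapSum_add_left,
      gapSum_mul_left, ih]
    ring

theorem gapSum_congr (s : Set A) {w : List A} (hw : ∀ x ∈ w, x ∈ s) {K L : List A → ℂ}
    (Φ : List A → ℂ)
    (h : ∀ u : List A, (∀ x ∈ u, x ∈ s) → u.length ≤ w.length → K u = L u) :
    gapSum φ w K Φ = gapSum φ w L Φ := by
  induction w generalizing K L Φ with
  | nil => simp [gapSum, h []]
  | cons y w ih =>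
    have hy : y ∈ s := hw y (by simp)
    have hw' : ∀ x ∈ w, x ∈ s := fun x hx => hw x (by simp [hx])
    simp only [gapSum]
    rw [ih hw' _ fun u hu hl => h u hu (by simp; omega),
      ih hw' _ fun u hu hl => h (y :: u) (by simpa using ⟨hy, hu⟩) (by simpa using hl)]

theorem gapSum_sub (h1 : φ [] = 1) (s : Set A) {w : List A} (hw : ∀ x ∈ w, x ∈ s) {K L : List A → ℂ}
    (h : ∀ u : List A, (∀ x ∈ u, x ∈ s) → u.length < w.length → K u = L u) :
    gapSum φ w K φ - gapSum φ w L φ = K w - L w := by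
  induction w generalizing K L with
  | nil => simp [gapSum, h1]
  | cons y w ih =>
    have hy : y ∈ s := hw y (by simp)
    have hw' : ∀ x ∈ w, x ∈ s := fun x hx => hw x (by simp [hx])
    simp only [gapSum, h1, one_mul]
    rw [gapSum_congr φ s hw' _ fun u hu hl => h u hu (by simp; omega), add_sub_add_left_eq_sub,
      ih hw' fun u hu hl => h (y :: u) (by simpa using ⟨hy, hu⟩) (by simpa using hl)]

/-- The weight of a subword is determined by the gap sums. -/
theorem eq_of_gapSum_eq (h1 : φ [] = 1) (s : Set A) {K L : List A → ℂ}
    (h : ∀ w : List A, (∀ x ∈ w, x ∈ s) → gapSum φ w K φ = gapSum φ w L φ)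
    (w : List A) (hw : ∀ x ∈ w, x ∈ s) : K w = L w := by
  induction hn : w.length using Nat.strong_induction_on generalizing w with
  | _ n ih =>
    have := gapSum_sub φ h1 s hw (K := K) (L := L) fun u hu hl => ih _ (hn ▸ hl) u hu rfl
    rw [h w hw, sub_self] at this
    exact (sub_eq_zero.mp this.symm)

theorem gapSum_zero (w : List A) (Φ : List A → ℂ) : gapSum φ w (fun _ => 0) Φ = 0 := by
  simpa using gapSum_mul_left φ w 0 (fun _ => 0) Φ

theorem gapSum_nil (w : List A) (Φ : List A → ℂ) :
    gapSum φ w (fun u => if u = [] then 1 else 0) Φ = Φ w := by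
  induction w generalizing Φ with
  | nil => simp [gapSum]
  | cons y w ih => simp [gapSum, ih, gapSum_zero]

/-- Cyclic invariance of cumulants of a tracial functional. -/
theorem cumulant_cyclic (h1 : φ [] = 1) (R : List A → ℂ)
    (hF : ∀ x w, φ (x :: w) = gapSum φ w (fun u => R (x :: u)) φ)
    (hL : ∀ x w, φ (w ++ [x]) = gapSum φ w (fun u => R (u ++ [x])) φ)
    (htr : ∀ x w, φ (x :: w) = φ (w ++ [x])) (x : A) (w : List A) :
    R (x :: w) = R (w ++ [x]) :=
  eq_of_gapSum_eq φ h1 Set.univ (K := fun u => R (x :: u)) (L := fun u => R (u ++ [x]))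
    (fun w _ => by rw [← hF, ← hL, htr]) w (by simp)

theorem cumulant_append_comm (h1 : φ [] = 1) (R : List A → ℂ)
    (hF : ∀ x w, φ (x :: w) = gapSum φ w (fun u => R (x :: u)) φ)
    (hL : ∀ x w, φ (w ++ [x]) = gapSum φ w (fun u => R (u ++ [x])) φ)
    (htr : ∀ x w, φ (x :: w) = φ (w ++ [x])) (u v : List A) :
    R (u ++ v) = R (v ++ u) := by
  induction u generalizing v with
  | nil => simp
  | cons x u ih =>
    rw [List.cons_append, cumulant_cyclic φ h1 R hF hL htr, List.append_assoc, ih]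
    simp

/-- Cumulants with an adjacent pair of entries whose product is the unit. -/
theorem cumulant_cancel (h1 : φ [] = 1) (R : List A → ℂ)
    (hF : ∀ x w, φ (x :: w) = gapSum φ w (fun u => R (x :: u)) φ)
    {a b : A} (hab : ∀ w, φ (a :: b :: w) = φ w) (w : List A) :
    R (a :: b :: w) + splitSum (fun u v => R (b :: u) * R (a :: v)) w =
      if w = [] then 1 else 0 := by
  refine eq_of_gapSum_eq φ h1 Set.univ
    (K := fun w => R (a :: b :: w) + splitSum (fun u v => R (b :: u) * R (a :: v)) w)
    (L := fun w => if w = [] then 1 else 0) (fun w _ => ?_) w (by simp)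
  rw [gapSum_nil, gapSum_add_left, ← gapSum_gapSum, ← hab w, hF a (b :: w), gapSum, h1, one_mul,
    add_comm]
  simp only [hF b]

end GapSum

/-- `P` is a non-crossing partition of the finite set `S` of positions. -/
structure IsNCOn (S : Finset ℕ) (P : Finset (Finset ℕ)) : Prop where
  nonempty : ∀ B ∈ P, B.Nonempty
  subset : ∀ B ∈ P, B ⊆ S
  cover : ∀ i ∈ S, ∃ B ∈ P, i ∈ B
  unique : ∀ B ∈ P, ∀ C ∈ P, ∀ i ∈ B, i ∈ C → B = C
  noncrossing : ∀ B ∈ P, ∀ C ∈ P, ∀ a ∈ B, ∀ b ∈ C, ∀ c ∈ B, ∀ d ∈ C,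
    a < b → b < c → c < d → B = C

/-- The non-crossing partitions of a finite set of positions. -/
def ncOn (S : Finset ℕ) : Finset (Finset (Finset ℕ)) :=
  S.powerset.powerset.filter (IsNCOn S)

theorem mem_ncOn {S : Finset ℕ} {P : Finset (Finset ℕ)} : P ∈ ncOn S ↔ IsNCOn S P := by
  simp only [ncOn, Finset.mem_filter, Finset.mem_powerset, and_iff_right_iff_imp]
  exact fun h B hB => Finset.mem_powerset.mpr (h.subset B hB)

/-- The multiplicative extension of `κ`, summed over the non-crossing partitions of `S`. -/
def ncMoment (κ : Finset ℕ → ℂ) (S : Finset ℕ) : ℂ := ∑ P ∈ ncOn S, ∏ B ∈ P, κ B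

/-- Non-crossing partitions having a block that contains `I` and avoids `O`. -/
def ncOnWith (S I O : Finset ℕ) : Finset (Finset (Finset ℕ)) :=
  (ncOn S).filter fun P => ∃ B ∈ P, I ⊆ B ∧ Disjoint B O

/-- The multiplicative extension of `κ`, summed over `ncOnWith S I O`. -/
def ncSum (κ : Finset ℕ → ℂ) (S I O : Finset ℕ) : ℂ := ∑ P ∈ ncOnWith S I O, ∏ B ∈ P, κ B

theorem ncMoment_eq_ncSum (κ : Finset ℕ → ℂ) {S : Finset ℕ} {x : ℕ} (hx : x ∈ S) :
    ncMoment κ S = ncSum κ S {x} ∅ := by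
  rw [ncMoment, ncSum, ncOnWith, Finset.filter_true_of_mem]
  intro P hP
  obtain ⟨B, hB, hxB⟩ := (mem_ncOn.mp hP).cover x hx
  exact ⟨B, hB, by simpa using hxB, by simp⟩

theorem ncSum_split (κ : Finset ℕ → ℂ) (S I O : Finset ℕ) (hI : I.Nonempty) (s : ℕ) :
    ncSum κ S I O = ncSum κ S I (insert s O) + ncSum κ S (insert s I) O := by
  have h : ncOnWith S I O = ncOnWith S I (insert s O) ∪ ncOnWith S (insert s I) O := by
    ext P
    simp only [ncOnWith, Finset.mem_union, Finset.mem_filter, ← and_or_left,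
      Finset.disjoint_insert_right, Finset.insert_subset_iff]
    refine and_congr_right fun _ => ⟨?_, ?_⟩
    · rintro ⟨B, hB, hIB, hBO⟩
      by_cases hs : s ∈ B
      · exact Or.inr ⟨B, hB, ⟨hs, hIB⟩, hBO⟩
      · exact Or.inl ⟨B, hB, hIB, hs, hBO⟩
    · rintro (⟨B, hB, hIB, -, hBO⟩ | ⟨B, hB, ⟨-, hIB⟩, hBO⟩) <;> exact ⟨B, hB, hIB, hBO⟩
  rw [ncSum, h, Finset.sum_union, ncSum, ncSum]
  rw [Finset.disjoint_left]
  intro P hP hP'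
  simp only [ncOnWith, Finset.mem_filter, Finset.disjoint_insert_right,
    Finset.insert_subset_iff] at hP hP'
  obtain ⟨hP, B, hB, hIB, hs, -⟩ := hP
  obtain ⟨-, C, hC, ⟨hs', hIC⟩, -⟩ := hP'
  obtain ⟨i, hi⟩ := hI
  exact hs ((mem_ncOn.mp hP).unique B hB C hC i (hIB hi) (hIC hi) ▸ hs')

section Factor

variable {U I g : Finset ℕ}

theorem subset_or_disjoint_of_mem_ncOnWith
    (hsep : ∀ b ∈ g, ∀ d ∈ U, d ∉ g → d ∉ I → ∃ u ∈ I, ∃ v ∈ I,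
      (u < b ∧ b < v ∧ v < d) ∨ (b < u ∧ u < d ∧ d < v))
    {P : Finset (Finset ℕ)} (hP : P ∈ ncOnWith U I g) {C : Finset ℕ} (hC : C ∈ P) :
    C ⊆ g ∨ Disjoint C g := by
  obtain ⟨hP, B, hB, hIB, hBg⟩ := Finset.mem_filter.mp hP
  have hP := mem_ncOn.mp hP
  by_contra! h
  obtain ⟨h₁, h₂⟩ := h
  obtain ⟨d, hdC, hdg⟩ := Finset.not_subset.mp h₁
  obtain ⟨b, hbC, hbg⟩ := Finset.not_disjoint_iff.mp h₂
  have hne : B ≠ C := fun h => Finset.disjoint_left.mp hBg (h ▸ hbC) hbg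
  have hdI : d ∉ I := fun h => hne (hP.unique B hB C hC d (hIB h) hdC)
  obtain ⟨u, hu, v, hv, ⟨h1, h2, h3⟩ | ⟨h1, h2, h3⟩⟩ := hsep b hbg d (hP.subset C hC hdC) hdg hdI
  · exact hne (hP.noncrossing B hB C hC u (hIB hu) b hbC v (hIB hv) d hdC h1 h2 h3)
  · exact hne (hP.noncrossing C hC B hB b hbC u (hIB hu) d hdC v (hIB hv) h1 h2 h3).symm

/-- A gap of the block through `I` is partitioned independently of the remaining positions. -/
theorem ncSum_factor (κ : Finset ℕ → ℂ) (hgU : g ⊆ U) (hI : I.Nonempty)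
    (h_inter : ∀ b ∈ g, ∀ d ∈ U, d ∉ g → ∀ b' ∈ g, ¬ (b < d ∧ d < b'))
    (hsep : ∀ b ∈ g, ∀ d ∈ U, d ∉ g → d ∉ I → ∃ u ∈ I, ∃ v ∈ I,
      (u < b ∧ b < v ∧ v < d) ∨ (b < u ∧ u < d ∧ d < v)) :
    ncSum κ U I g = ncMoment κ g * ncSum κ (U \ g) I ∅ := by
  rw [ncMoment, ncSum, ncSum, Finset.sum_mul_sum, ← Finset.sum_product']
  have aux : ∀ p ∈ ncOn g ×ˢ ncOnWith (U \ g) I ∅, (∀ B ∈ p.1, B ⊆ g) ∧ ∀ B ∈ p.2, ¬ B ⊆ g := by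
    intro p hp
    obtain ⟨h₁, h₂⟩ := Finset.mem_product.mp hp
    refine ⟨(mem_ncOn.mp h₁).subset, fun B hB hBg => ?_⟩
    have h₂ := mem_ncOn.mp (Finset.mem_filter.mp h₂).1
    obtain ⟨i, hi⟩ := h₂.nonempty B hB
    exact (Finset.mem_sdiff.mp (h₂.subset B hB hi)).2 (hBg hi)
  refine Finset.sum_bij' (fun P _ => (P.filter (· ⊆ g), P.filter (¬ · ⊆ g)))
    (fun p _ => p.1 ∪ p.2) ?_ ?_ ?_ ?_ ?_
  · intro P hP'
    have hd := fun C hC => subset_or_disjoint_of_mem_ncOnWith hsep hP' (C := C) hC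
    obtain ⟨hP, B, hB, hIB, hBg⟩ := Finset.mem_filter.mp hP'
    have hP := mem_ncOn.mp hP
    refine Finset.mem_product.mpr ⟨mem_ncOn.mpr ⟨?_, ?_, ?_, ?_, ?_⟩,
      Finset.mem_filter.mpr ⟨mem_ncOn.mpr ⟨?_, ?_, ?_, ?_, ?_⟩, B, ?_, hIB, by simp⟩⟩
    · exact fun C hC => hP.nonempty C (Finset.mem_filter.mp hC).1
    · exact fun C hC => (Finset.mem_filter.mp hC).2
    · intro i hi
      obtain ⟨C, hC, hiC⟩ := hP.cover i (hgU hi)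
      refine ⟨C, Finset.mem_filter.mpr ⟨hC, (hd C hC).resolve_right fun h => ?_⟩, hiC⟩
      exact Finset.disjoint_left.mp h hiC hi
    · exact fun C hC D hD => hP.unique C (Finset.mem_filter.mp hC).1 D (Finset.mem_filter.mp hD).1
    · exact fun C hC D hD =>
        hP.noncrossing C (Finset.mem_filter.mp hC).1 D (Finset.mem_filter.mp hD).1
    · exact fun C hC => hP.nonempty C (Finset.mem_filter.mp hC).1
    · intro C hC i hi
      obtain ⟨hC, hCg⟩ := Finset.mem_filter.mp hC
      exact Finset.mem_sdiff.mpr ⟨hP.subset C hC hi,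
        Finset.disjoint_left.mp ((hd C hC).resolve_left hCg) hi⟩
    · intro i hi
      obtain ⟨hiU, hig⟩ := Finset.mem_sdiff.mp hi
      obtain ⟨C, hC, hiC⟩ := hP.cover i hiU
      exact ⟨C, Finset.mem_filter.mpr ⟨hC, fun h => hig (h hiC)⟩, hiC⟩
    · exact fun C hC D hD => hP.unique C (Finset.mem_filter.mp hC).1 D (Finset.mem_filter.mp hD).1
    · exact fun C hC D hD =>
        hP.noncrossing C (Finset.mem_filter.mp hC).1 D (Finset.mem_filter.mp hD).1
    · refine Finset.mem_filter.mpr ⟨hB, fun h => ?_⟩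
      obtain ⟨i, hi⟩ := hI
      exact Finset.disjoint_left.mp hBg (hIB hi) (h (hIB hi))
  · intro p hp
    obtain ⟨h₁, h₂⟩ := Finset.mem_product.mp hp
    obtain ⟨h₂, B, hB, hIB, -⟩ := Finset.mem_filter.mp h₂
    have h₁ := mem_ncOn.mp h₁
    have h₂ := mem_ncOn.mp h₂
    have hout : ∀ C ∈ p.2, ∀ i ∈ C, i ∈ U ∧ i ∉ g := fun C hC i hi =>
      Finset.mem_sdiff.mp (h₂.subset C hC hi)
    refine Finset.mem_filter.mpr ⟨mem_ncOn.mpr ⟨?_, ?_, ?_, ?_, ?_⟩, B,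
      Finset.mem_union_right _ hB, hIB,
      Finset.disjoint_left.mpr fun i hi => (hout B hB i hi).2⟩
    · intro C hC
      exact (Finset.mem_union.mp hC).elim (h₁.nonempty C) (h₂.nonempty C)
    · intro C hC
      exact (Finset.mem_union.mp hC).elim (fun h => (h₁.subset C h).trans hgU)
        fun h => (h₂.subset C h).trans Finset.sdiff_subset
    · intro i hi
      by_cases hig : i ∈ g
      · obtain ⟨C, hC, hiC⟩ := h₁.cover i hig
        exact ⟨C, Finset.mem_union_left _ hC, hiC⟩
      · obtain ⟨C, hC, hiC⟩ := h₂.cover i (Finset.mem_sdiff.mpr ⟨hi, hig⟩)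
        exact ⟨C, Finset.mem_union_right _ hC, hiC⟩
    · intro C hC D hD i hiC hiD
      rcases Finset.mem_union.mp hC with hC | hC <;> rcases Finset.mem_union.mp hD with hD | hD
      · exact h₁.unique C hC D hD i hiC hiD
      · exact absurd (h₁.subset C hC hiC) (hout D hD i hiD).2
      · exact absurd (h₁.subset D hD hiD) (hout C hC i hiC).2
      · exact h₂.unique C hC D hD i hiC hiD
    · intro C hC D hD a ha b hb c hc d hd h12 h23 h34
      rcases Finset.mem_union.mp hC with hC | hC <;> rcases Finset.mem_union.mp hD with hD | hD
      · exact h₁.noncrossing C hC D hD a ha b hb c hc d hd h12 h23 h34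
      · exact absurd ⟨h12, h23⟩ (h_inter a (h₁.subset C hC ha) b (hout D hD b hb).1
          (hout D hD b hb).2 c (h₁.subset C hC hc))
      · exact absurd ⟨h23, h34⟩ (h_inter b (h₁.subset D hD hb) c (hout C hC c hc).1
          (hout C hC c hc).2 d (h₁.subset D hD hd))
      · exact h₂.noncrossing C hC D hD a ha b hb c hc d hd h12 h23 h34
  · intro P _
    exact Finset.filter_union_filter_not_eq _ _
  · intro p hp
    obtain ⟨h₁, h₂⟩ := aux p hp
    refine Prod.ext ?_ ?_ <;> ext C <;> simp only [Finset.mem_filter, Finset.mem_union]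
    · exact ⟨fun h => h.1.resolve_right fun h' => h₂ C h' h.2, fun h => ⟨Or.inl h, h₁ C h⟩⟩
    · exact ⟨fun h => h.1.resolve_left fun h' => h.2 (h₁ C h'), fun h => ⟨Or.inr h, h₂ C h⟩⟩
  · intro P _
    exact (Finset.prod_filter_mul_prod_filter_not P (· ⊆ g) κ).symm

end Factor

theorem ncOnWith_self {I : Finset ℕ} (hI : I.Nonempty) : ncOnWith I I ∅ = {{I}} := by
  ext P
  simp only [ncOnWith, Finset.mem_filter, mem_ncOn, Finset.mem_singleton]
  constructor
  · rintro ⟨hP, B, hB, hIB, -⟩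
    obtain rfl : B = I := (hP.subset B hB).antisymm hIB
    refine Finset.eq_singleton_iff_unique_mem.mpr ⟨hB, fun C hC => ?_⟩
    obtain ⟨i, hi⟩ := hP.nonempty C hC
    exact hP.unique C hC B hB i hi (hP.subset C hC hi)
  · rintro rfl
    refine ⟨⟨?_, ?_, ?_, ?_, ?_⟩, I, by simp, subset_rfl, by simp⟩ <;> simp [hI]

/-- The part of the moment-cumulant formula in which the block of the extreme position `x` starts
with `V` and skips `g` is a gap sum over the remaining positions. -/
theorem ncSum_eq_gapSum {A : Type*} (κ : Finset ℕ → ℂ) (a : ℕ → A) (φ K : List A → ℂ) (x : ℕ)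
    (p : ℕ → Prop) (hK : ∀ V : List ℕ, V.Pairwise (· < ·) → (∀ i ∈ V, p i) →
      κ (insert x V.toFinset) = K (V.map a))
    (hφ : ∀ g : List ℕ, g.Pairwise (· < ·) → ncMoment κ g.toFinset = φ (g.map a))
    (V g s : List ℕ) (hs : (V ++ g ++ s).Pairwise (· < ·)) (hp : ∀ i ∈ V ++ g ++ s, p i)
    (hx : (∀ i ∈ V ++ g ++ s, x < i) ∨ ∀ i ∈ V ++ g ++ s, i < x) :
    ncSum κ (insert x (V ++ g ++ s).toFinset) (insert x V.toFinset) g.toFinset =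
      gapSum φ (s.map a) (fun u => K (V.map a ++ u)) (fun u => φ (g.map a ++ u)) := by
  induction s generalizing V g with
  | nil =>
    simp only [List.append_nil] at hs hx ⊢
    have hsV := (List.pairwise_append.mp hs).1
    have hsg := (List.pairwise_append.mp hs).2.1
    have hVg := (List.pairwise_append.mp hs).2.2
    have hxg : x ∉ g := by
      intro h
      rcases hx with hx | hx <;> exact lt_irrefl _ (hx x (by simp [h]))
    rw [ncSum_factor]
    · have : insert x (V ++ g).toFinset \ g.toFinset = insert x V.toFinset := by
        ext i
        simp only [Finset.mem_sdiff, Finset.mem_insert, List.mem_toFinset, List.mem_append]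
        constructor
        · rintro ⟨rfl | h | h, h'⟩ <;> simp_all
        · rintro (rfl | h)
          · exact ⟨Or.inl rfl, hxg⟩
          · exact ⟨Or.inr (Or.inl h), fun h' => lt_irrefl _ (hVg i h i h')⟩
      rw [this, ncSum, ncOnWith_self (by simp), Finset.sum_singleton, Finset.prod_singleton,
        hK V hsV fun i hi => hp i (by simp [hi]), hφ g hsg]
      simp [gapSum, mul_comm]
    · intro i hi
      simp only [Finset.mem_insert, List.mem_toFinset, List.mem_append] at hi ⊢
      exact Or.inr (Or.inr hi)
    · simp
    · intro b hb d hd hdg b' hb' h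
      simp only [Finset.mem_insert, List.mem_toFinset, List.mem_append] at hb hd hdg hb' hx
      rcases hd with rfl | hd | hd
      · rcases hx with hx | hx
        · exact lt_asymm h.1 (hx b (Or.inr hb))
        · exact lt_asymm h.2 (hx b' (Or.inr hb'))
      · exact lt_asymm h.1 (hVg d hd b hb)
      · exact hdg hd
    · intro b hb d hd hdg hdI
      simp only [Finset.mem_insert, List.mem_toFinset, List.mem_append] at hd hdg hdI
      tauto
  | cons y s ih =>
    have e1 : V ++ g ++ y :: s = V ++ (g ++ [y]) ++ s := by simp
    have hs1 : (V ++ (g ++ [y]) ++ s).Pairwise (· < ·) := e1 ▸ hs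
    have hsub : List.Sublist (V ++ [y] ++ [] ++ s) (V ++ g ++ y :: s) := by
      simp
    have hs2 := hs.sublist hsub
    have hsg : g.Pairwise (· < ·) := hs.sublist (by simp)
    have hVg : ∀ i ∈ V, ∀ j ∈ g, i < j := by
      intro i hi j hj
      simp only [List.pairwise_append] at hs
      exact hs.1.2.2 i hi j hj
    have hgy : ∀ j ∈ g, j < y := by
      intro j hj
      exact (List.pairwise_append.mp hs).2.2 j (by simp [hj]) y (by simp)
    have hys : ∀ j ∈ s, y < j := by
      intro j hj
      exact (List.pairwise_cons.mp (List.pairwise_append.mp hs).2.1).1 j hj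
    have hxg : x ∉ g := by
      intro h
      rcases hx with hx | hx <;> exact lt_irrefl _ (hx x (by simp [h]))
    rw [ncSum_split κ _ _ _ (by simp) y, List.map_cons, gapSum]
    congr 1
    · have := ih V (g ++ [y]) hs1 (e1 ▸ hp) (e1 ▸ hx)
      rw [← e1] at this
      rw [show insert y g.toFinset = (g ++ [y]).toFinset by ext; simp, this]
      simp
    · rw [ncSum_factor, hφ g hsg]
      · have := ih (V ++ [y]) [] hs2 (fun i hi => hp i (hsub.subset hi)) (hx.imp (fun h i hi => h i (hsub.subset hi))
          fun h i hi => h i (hsub.subset hi))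
        simp only [List.append_nil, List.map_append, List.map_cons, List.map_nil,
          List.append_assoc, List.cons_append, List.nil_append, List.toFinset_nil] at this ⊢
        rw [← this]
        congr 2
        · ext i
          simp only [Finset.mem_sdiff, Finset.mem_insert, List.mem_toFinset, List.mem_append,
            List.mem_cons]
          constructor
          · rintro ⟨h | h | h | h | h, h'⟩
            · exact Or.inl h
            · exact Or.inr (Or.inl h)
            · exact absurd h h'
            · exact Or.inr (Or.inr (Or.inl h))
            · exact Or.inr (Or.inr (Or.inr h))
          · rintro (rfl | h | rfl | h)
            · exact ⟨Or.inl rfl, hxg⟩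
            · exact ⟨Or.inr (Or.inl h), fun h' => lt_irrefl _ (hVg i h i h')⟩
            · exact ⟨by simp, fun h' => lt_irrefl _ (hgy i h')⟩
            · exact ⟨by simp [h], fun h' => lt_asymm (hgy i h') (hys i h)⟩
        · ext i
          simp only [Finset.mem_insert, List.mem_toFinset, List.mem_append, List.mem_cons,
            List.not_mem_nil, or_false]
          rw [or_left_comm, or_comm (a := i = y)]
      · intro i hi
        simp only [Finset.mem_insert, List.mem_toFinset, List.mem_append] at hi ⊢
        exact Or.inr (Or.inl (Or.inr hi))
      · simp
      · intro b hb d hd hdg b' hb' h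
        simp only [Finset.mem_insert, List.mem_toFinset, List.mem_append, List.mem_cons]
          at hb hd hdg hb' hx
        rcases hd with rfl | (hd | hd) | rfl | hd
        · rcases hx with hx | hx
          · exact lt_asymm h.1 (hx b (Or.inl (Or.inr hb)))
          · exact lt_asymm h.2 (hx b' (Or.inl (Or.inr hb')))
        · exact lt_asymm h.1 (hVg d hd b hb)
        · exact hdg hd
        · exact lt_asymm h.2 (hgy b' hb')
        · exact lt_asymm h.2 ((hgy b' hb').trans (hys d hd))
      · intro b hb d hd hdg hdI
        simp only [Finset.mem_insert, List.mem_toFinset, List.mem_append, List.mem_cons]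
          at hb hd hdg hdI hx
        have hds : d ∈ s := by tauto
        rcases hx with hx | hx
        · exact ⟨x, by simp, y, by simp, Or.inl ⟨hx b (by tauto), hgy b hb, hys d hds⟩⟩
        · exact ⟨y, by simp, x, by simp, Or.inr ⟨hgy b hb, hys d hds, hx d (by tauto)⟩⟩

/-- Moment-cumulant formula organised by the block of an extreme position. -/
theorem ncMoment_eq_gapSum {A : Type*} (κ : Finset ℕ → ℂ) (a : ℕ → A) (φ K : List A → ℂ) (x : ℕ)
    (p : ℕ → Prop) (hK : ∀ V : List ℕ, V.Pairwise (· < ·) → (∀ i ∈ V, p i) →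
      κ (insert x V.toFinset) = K (V.map a))
    (hφ : ∀ g : List ℕ, g.Pairwise (· < ·) → ncMoment κ g.toFinset = φ (g.map a))
    (s : List ℕ) (hs : s.Pairwise (· < ·)) (hp : ∀ i ∈ s, p i)
    (hx : (∀ i ∈ s, x < i) ∨ ∀ i ∈ s, i < x) :
    ncMoment κ (insert x s.toFinset) = gapSum φ (s.map a) K φ := by
  rw [ncMoment_eq_ncSum κ (Finset.mem_insert_self x _)]
  simpa using ncSum_eq_gapSum κ a φ K x p hK hφ [] [] s (by simpa using hs)
    (by simpa using hp) (by simpa using hx)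

section MomentCumulantList

variable {A : Type*}

/-- A cumulant functional evaluated on a list. -/
def listCum (R : ∀ n, (Fin n → A) → ℂ) (l : List A) : ℂ := R l.length l.get

theorem listCum_ofFn (R : ∀ n, (Fin n → A) → ℂ) {n : ℕ} (f : Fin n → A) :
    listCum R (List.ofFn f) = R n f := by
  have h : ∀ (l : List A) (m : ℕ) (hm : m = l.length),
      listCum R l = R m fun i => l.get (i.cast hm) := by
    rintro l m rfl
    rfl
  rw [h _ n (by simp)]
  congr 1
  ext i
  simp

theorem blockCum_eq_listCum (R : ∀ n, (Fin n → A) → ℂ) {n : ℕ} (X : Fin n → A)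
    (B : Finset (Fin n)) : blockCum R X B = listCum R ((B.sort (· ≤ ·)).map X) := by
  refine (listCum_ofFn R _).symm.trans (congrArg _ ?_)
  refine List.ext_getElem (by simp) fun i h₁ h₂ => ?_
  simp

/-- Non-crossing partitions of `Fin n` correspond to those of the range of an increasing map. -/
theorem sum_NC_eq_ncMoment (κ : Finset ℕ → ℂ) {n : ℕ} (e : Fin n ↪o ℕ) :
    ∑ P ∈ NC n, ∏ B ∈ P, κ (B.map e.toEmbedding) =
      ncMoment κ (Finset.univ.map e.toEmbedding) := by
  have hmap : ∀ C : Finset ℕ, C ⊆ Finset.univ.map e.toEmbedding →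
      (Finset.univ.filter fun i => e i ∈ C).map e.toEmbedding = C := by
    intro C hC
    ext c
    simp only [Finset.mem_map, Finset.mem_filter, Finset.mem_univ, true_and]
    constructor
    · rintro ⟨i, hi, rfl⟩
      exact hi
    · intro hc
      obtain ⟨i, -, rfl⟩ := Finset.mem_map.mp (hC hc)
      exact ⟨i, hc, rfl⟩
  have hfil : ∀ B : Finset (Fin n),
      (Finset.univ.filter fun i => e i ∈ B.map e.toEmbedding) = B := by
    intro B
    ext i
    simp
  refine Finset.sum_bij'
    (fun P _ => P.image fun B => B.map e.toEmbedding)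
    (fun Q _ => Q.image fun C => Finset.univ.filter fun i => e i ∈ C) ?_ ?_ ?_ ?_ ?_
  · intro P hP
    obtain ⟨⟨hne, hcov⟩, hnc⟩ := (Finset.mem_filter.mp hP).2
    refine mem_ncOn.mpr ⟨?_, ?_, ?_, ?_, ?_⟩
    · intro C hC
      obtain ⟨B, hB, rfl⟩ := Finset.mem_image.mp hC
      exact (hne B hB).map
    · intro C hC
      obtain ⟨B, hB, rfl⟩ := Finset.mem_image.mp hC
      exact Finset.map_subset_map.mpr (Finset.subset_univ _)
    · intro i hi
      obtain ⟨i, -, rfl⟩ := Finset.mem_map.mp hi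
      obtain ⟨B, ⟨hB, hiB⟩, -⟩ := hcov i
      exact ⟨_, Finset.mem_image_of_mem _ hB, Finset.mem_map_of_mem _ hiB⟩
    · intro C hC D hD i hi hi'
      obtain ⟨B, hB, rfl⟩ := Finset.mem_image.mp hC
      obtain ⟨B', hB', rfl⟩ := Finset.mem_image.mp hD
      obtain ⟨j, hj, rfl⟩ := Finset.mem_map.mp hi
      rw [Finset.mem_map' e.toEmbedding] at hi'
      rw [(hcov j).unique ⟨hB, hj⟩ ⟨hB', hi'⟩]
    · intro C hC D hD x hx y hy z hz t ht h1 h2 h3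
      obtain ⟨B, hB, rfl⟩ := Finset.mem_image.mp hC
      obtain ⟨B', hB', rfl⟩ := Finset.mem_image.mp hD
      obtain ⟨x', hx', rfl⟩ := Finset.mem_map.mp hx
      obtain ⟨y', hy', rfl⟩ := Finset.mem_map.mp hy
      obtain ⟨z', hz', rfl⟩ := Finset.mem_map.mp hz
      obtain ⟨t', ht', rfl⟩ := Finset.mem_map.mp ht
      rw [hnc B hB B' hB' x' hx' y' hy' z' hz' t' ht' (e.lt_iff_lt.mp h1) (e.lt_iff_lt.mp h2)
        (e.lt_iff_lt.mp h3)]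
  · intro Q hQ
    have hQ := mem_ncOn.mp hQ
    refine Finset.mem_filter.mpr ⟨Finset.mem_univ _, ⟨?_, ?_⟩, ?_⟩
    · intro B hB
      obtain ⟨C, hC, rfl⟩ := Finset.mem_image.mp hB
      rw [← Finset.map_nonempty (f := e.toEmbedding), hmap C (hQ.subset C hC)]
      exact hQ.nonempty C hC
    · intro i
      obtain ⟨C, hC, hiC⟩ := hQ.cover (e i) (Finset.mem_map_of_mem _ (Finset.mem_univ i))
      refine ⟨_, ⟨Finset.mem_image_of_mem _ hC, by simpa using hiC⟩, ?_⟩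
      rintro B ⟨hB, hiB⟩
      obtain ⟨D, hD, rfl⟩ := Finset.mem_image.mp hB
      rw [hQ.unique C hC D hD (e i) hiC (by simpa using hiB)]
    · intro B hB B' hB' x hx y hy z hz t ht h1 h2 h3
      obtain ⟨C, hC, rfl⟩ := Finset.mem_image.mp hB
      obtain ⟨D, hD, rfl⟩ := Finset.mem_image.mp hB'
      simp only [Finset.mem_filter, Finset.mem_univ, true_and] at hx hy hz ht
      rw [hQ.noncrossing C hC D hD _ hx _ hy _ hz _ ht (e.lt_iff_lt.mpr h1) (e.lt_iff_lt.mpr h2)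
        (e.lt_iff_lt.mpr h3)]
  · intro P _
    rw [Finset.image_image]
    simp only [Function.comp_def, hfil, Finset.image_id']
  · intro Q hQ
    rw [Finset.image_image]
    conv_rhs => rw [← Finset.image_id (s := Q)]
    exact Finset.image_congr fun C hC => hmap C ((mem_ncOn.mp hQ).subset C hC)
  · intro P _
    rw [Finset.prod_image]
    exact fun B _ B' _ h => Finset.map_injective _ h

variable [Monoid A] {φ : A → ℂ} {R : ∀ n, (Fin n → A) → ℂ} (hmc : MomentCumulant φ R)
include hmc

theorem MomentCumulant.ncMoment_eq (a : ℕ → A) (g : List ℕ) (hg : g.Pairwise (· < ·)) :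
    ncMoment (fun B => listCum R ((B.sort (· ≤ ·)).map a)) g.toFinset = φ (g.map a).prod := by
  let e : Fin g.length ↪o ℕ := OrderEmbedding.ofStrictMono g.get hg.sortedLT.strictMono_get
  have hu : Finset.univ.map e.toEmbedding = g.toFinset := by
    ext i
    simp [e, List.mem_iff_get]
  rw [← hu, ← sum_NC_eq_ncMoment]
  have h := hmc g.length fun i => a (g.get i)
  rw [tprod, show (List.ofFn fun i => a (g.get i)) = g.map a by
    rw [← List.ofFn_get (g.map a)]
    exact List.ext_getElem (by simp) fun i _ _ => by simp] at h
  rw [h]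
  refine Finset.sum_congr rfl fun P _ => Finset.prod_congr rfl fun B _ => ?_
  rw [blockCum_eq_listCum, ← Finset.map_sort e.toEmbedding B (· ≤ ·) (· ≤ ·)
    fun i _ j _ => e.le_iff_le.symm, List.map_map]
  rfl

theorem MomentCumulant.prod_cons (x : A) (w : List A) :
    φ (x :: w).prod =
      gapSum (fun u => φ u.prod) w (fun u => listCum R (x :: u)) (fun u => φ u.prod) := by
  let a : ℕ → A := fun i => (x :: w).getD i x
  have hw : (List.range' 1 w.length).map a = w := by
    refine List.ext_getElem (by simp) fun i h₁ h₂ => ?_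
    simp [a, add_comm 1 i, h₂]
  have hs : (List.range' 1 w.length).Pairwise (· < ·) := List.pairwise_lt_range'
  have hpos : ∀ i ∈ List.range' 1 w.length, 0 < i := fun i hi => by
    have := List.mem_range'_1.mp hi
    omega
  have h := ncMoment_eq_gapSum (fun B => listCum R ((B.sort (· ≤ ·)).map a)) a
    (fun u => φ u.prod) (fun u => listCum R (x :: u)) 0 (0 < ·) ?_ (hmc.ncMoment_eq a)
    (List.range' 1 w.length) hs hpos (Or.inl hpos)
  · rw [hw, ← List.toFinset_cons, hmc.ncMoment_eq a _ (List.pairwise_cons.mpr ⟨hpos, hs⟩),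
      List.map_cons, hw] at h
    exact h
  · intro V hV hp
    have hV' : (0 :: V).Pairwise (· < ·) := List.pairwise_cons.mpr ⟨hp, hV⟩
    rw [← List.toFinset_cons,
      (List.toFinset_sort (· ≤ ·) (hV'.imp ne_of_lt)).mpr (hV'.imp le_of_lt)]
    simp [a]

theorem MomentCumulant.prod_concat (x : A) (w : List A) :
    φ (w ++ [x]).prod =
      gapSum (fun u => φ u.prod) w (fun u => listCum R (u ++ [x])) (fun u => φ u.prod) := by
  let a : ℕ → A := fun i => (w ++ [x]).getD i x
  have hw : (List.range w.length).map a = w := by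
    refine List.ext_getElem (by simp) fun i h₁ h₂ => ?_
    simp [a, h₂, List.getElem?_append_left]
  have hs : (List.range w.length).Pairwise (· < ·) := List.pairwise_lt_range
  have hpos : ∀ i ∈ List.range w.length, i < w.length := fun i hi => List.mem_range.mp hi
  have hins : ∀ V : List ℕ, insert w.length V.toFinset = (V ++ [w.length]).toFinset := by
    intro V
    ext i
    simp
  have hsort : ∀ V : List ℕ, V.Pairwise (· < ·) → (∀ i ∈ V, i < w.length) →
      (V ++ [w.length]).Pairwise (· < ·) := by
    intro V hV hp
    simpa [List.pairwise_append, hV] using hp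
  have ha : a w.length = x := by simp [a]
  have h := ncMoment_eq_gapSum (fun B => listCum R ((B.sort (· ≤ ·)).map a)) a
    (fun u => φ u.prod) (fun u => listCum R (u ++ [x])) w.length (· < w.length) ?_
    (hmc.ncMoment_eq a) (List.range w.length) hs hpos (Or.inr hpos)
  · rw [hw, hins, hmc.ncMoment_eq a _ (hsort _ hs hpos), List.map_append, hw, List.map_singleton,
      ha] at h
    exact h
  · intro V hV hp
    have hV' := hsort V hV hp
    rw [hins, (List.toFinset_sort (· ≤ ·) (hV'.imp ne_of_lt)).mpr (hV'.imp le_of_lt),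
      List.map_append, List.map_singleton, ha]

end MomentCumulantList

theorem catalan_div_recursion {c : ℂ} (hc : c ≠ 0) (k : ℕ) :
    c * ((catalan (k + 1) : ℂ) / c ^ (2 * (k + 1) + 1)) =
      ∑ i ∈ Finset.range (k + 1),
        (catalan i : ℂ) / c ^ (2 * i + 1) * ((catalan (k - i) : ℂ) / c ^ (2 * (k - i) + 1)) := by
  rw [catalan_succ, Nat.cast_sum, Finset.sum_div, Finset.mul_sum, Finset.sum_range]
  refine Finset.sum_congr rfl fun i _ => ?_
  have hi := i.2
  rw [Nat.cast_mul, div_mul_div_comm, ← pow_add, mul_div_assoc',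
    show 2 * (k + 1) + 1 = (2 * (i : ℕ) + 1 + (2 * (k - i) + 1)) + 1 by omega,
    pow_succ _ (2 * (i : ℕ) + 1 + (2 * (k - i) + 1))]
  field_simp

section UnaryWords

open PowerSeries

theorem marchenkoPastur_quadratic {c : ℂ} {m : ℕ → ℂ} (h0 : m 0 = 1) (h1 : m 1 = 1 + c)
    (h : ∀ k : ℕ, ((k : ℂ) + 3) * m (k + 2) =
      (2 * k + 3) * (2 + c) * m (k + 1) - k * c ^ 2 * m k) :
    PowerSeries.mk m = 1 + C c * X * PowerSeries.mk m + X * PowerSeries.mk m ^ 2 := by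
  set M := PowerSeries.mk m with hM
  set N : PowerSeries ℂ := 2 * X * M - 1 + C c * X with hN
  set D : PowerSeries ℂ := 1 - C (2 * c + 4) * X + C (c ^ 2) * X ^ 2 with hD
  have hode : D * d⁄dX ℂ N = (C (c ^ 2) * X - C (c + 2)) * N := by
    have e : N = PowerSeries.mk fun k => match k with
        | 0 => -1
        | 1 => 2 + c
        | k + 2 => 2 * m (k + 1) := by
      ext k
      have hN' : N = C 2 * (X * M) - 1 + C c * X := by
        rw [hN, mul_assoc]
        rfl
      rw [hN', hM]
      rcases k with _ | _ | k
      · simp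
      · simp [coeff_succ_X_mul, h0, PowerSeries.coeff_one]
      · simp [coeff_succ_X_mul, PowerSeries.coeff_one]
    have e1 : D * d⁄dX ℂ N = d⁄dX ℂ N - C (2 * c + 4) * (X * d⁄dX ℂ N) +
        C (c ^ 2) * (X * (X * d⁄dX ℂ N)) := by
      rw [hD]
      ring
    have e2 : (C (c ^ 2) * X - C (c + 2)) * N = C (c ^ 2) * (X * N) - C (c + 2) * N := by ring
    rw [e1, e2, e]
    clear_value N D
    generalize hp : 2 * c + 4 = p
    generalize hq : c ^ 2 = q at h ⊢
    generalize hr : c + 2 = r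
    ext k
    rcases k with _ | _ | _ | k
    · simp only [map_sub, map_add, coeff_C_mul, coeff_zero_X_mul, coeff_derivative, coeff_mk]
      norm_num
      linear_combination hr
    · simp only [map_sub, map_add, coeff_C_mul, coeff_succ_X_mul, coeff_zero_X_mul,
        coeff_derivative, coeff_mk, h1]
      norm_num
      subst hp hq hr
      ring
    · have := h 0
      simp only [map_sub, map_add, coeff_C_mul, coeff_succ_X_mul, coeff_derivative, coeff_mk]
      norm_num at this ⊢
      subst hp hq hr
      linear_combination 2 * this
    · have := h (k + 1)
      simp only [map_sub, map_add, coeff_C_mul, coeff_succ_X_mul, coeff_derivative, coeff_mk]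
      push_cast at this ⊢
      subst hp hq hr
      linear_combination 2 * this
  have hD' : d⁄dX ℂ D = 2 * (C (c ^ 2) * X - C (c + 2)) := by
    have : C (2 * c + 4) = 2 * C (c + 2) := by
      rw [show (2 : PowerSeries ℂ) = C 2 from rfl, ← map_mul]
      congr 1
      ring
    have h2 : d⁄dX ℂ (C (2 * c + 4)) = 0 := PowerSeries.derivative_C
    have h3 : d⁄dX ℂ (C (c ^ 2)) = 0 := PowerSeries.derivative_C
    rw [hD, map_add, map_sub, Derivation.leibniz, Derivation.leibniz, Derivation.leibniz_pow, h3,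
      h2, this]
    simp only [smul_eq_mul, nsmul_eq_mul, derivative_X, Derivation.map_one_eq_zero]
    push_cast
    ring
  have hD0 : constantCoeff D ≠ 0 := by simp [hD]
  have hE : (N ^ 2 - D) * D⁻¹ = 0 := by
    apply PowerSeries.derivative.ext
    · rw [Derivation.leibniz, derivative_inv', map_zero, smul_eq_mul, smul_eq_mul, map_sub,
        Derivation.leibniz_pow, hD']
      have hDi : D * D⁻¹ = 1 := PowerSeries.mul_inv_cancel _ hD0
      simp only [smul_eq_mul, nsmul_eq_mul]
      push_cast
      linear_combination (2 * N * D⁻¹ ^ 2) * hode + (2 * (C (c ^ 2) * X - C (c + 2)) * D⁻¹  -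
        2 * N * D⁻¹ * d⁄dX ℂ N ) * hDi
    · simp [hN, hD]
  have hE' : N ^ 2 = D := by
    rcases mul_eq_zero.mp hE with h | h
    · exact sub_eq_zero.mp h
    · exact absurd ((PowerSeries.inv_eq_zero).mp h) hD0
  have h4 : (4 * X : PowerSeries ℂ) ≠ 0 := by
    refine mul_ne_zero ?_ X_ne_zero
    rw [show (4 : PowerSeries ℂ) = C 4 from rfl, Ne, map_eq_zero_iff _ PowerSeries.C_injective]
    norm_num
  refine mul_left_cancel₀ h4 ?_
  have hc : C (c ^ 2) = (C c) ^ 2 := map_pow _ _ _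
  have hc' : C (2 * c + 4) = 2 * C c + 4 := by
    rw [map_add, map_mul]
    rfl
  rw [hN, hD, hc, hc'] at hE'
  linear_combination -hE'

variable {A : Type*} (φ : List A → ℂ) (y : A)

/-- Generating series of a function of words on the powers of one letter. -/
def unarySeries (F : List A → ℂ) : PowerSeries ℂ :=
  PowerSeries.mk fun k => F (List.replicate k y)

theorem unarySeries_eq (F : List A → ℂ) :
    unarySeries y F = C (F []) + X * unarySeries y fun u => F (y :: u) := by
  ext k
  rcases k with _ | k
  · simp [unarySeries]
  · simp [unarySeries, coeff_succ_X_mul, List.replicate_succ]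

theorem unarySeries_gapSum (K Φ : List A → ℂ) :
    unarySeries y (fun u => gapSum φ u K Φ) = C (K []) * unarySeries y Φ +
      X * (unarySeries y Φ * unarySeries y fun u => gapSum φ u (fun v => K (y :: v)) φ) := by
  ext k
  induction k generalizing Φ with
  | zero => simp [unarySeries, gapSum]
  | succ k ih =>
    have h := ih fun u => Φ (y :: u)
    set T := unarySeries y fun u => gapSum φ u (fun v => K (y :: v)) φ with hT
    have e : coeff (k + 1) (unarySeries y fun u => gapSum φ u K Φ) =
        coeff k (unarySeries y fun u => gapSum φ u K fun u => Φ (y :: u)) + Φ [] * coeff k T := by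
      simp [unarySeries, hT, List.replicate_succ, gapSum]
    rw [e, h, unarySeries_eq y Φ]
    simp only [map_add, mul_add, add_mul, coeff_succ_X_mul, mul_assoc, coeff_C_mul,
      PowerSeries.coeff_C]
    simp
    ring

variable {φ} (h1 : φ [] = 1) {R : List A → ℂ}
  (hF : ∀ x w, φ (x :: w) = gapSum φ w (fun u => R (x :: u)) φ)
include h1 hF

theorem cumulant_eq_of_unarySeries {y : A} {c : ℂ}
    (hM : unarySeries y φ = 1 + C c * X * unarySeries y φ + X * unarySeries y φ ^ 2) (k : ℕ) :
    R (List.replicate (k + 1) y) = c + 1 := by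
  set M := unarySeries y φ with hMdef
  set N := unarySeries y fun u => φ (y :: u) with hN
  have hMN : M = 1 + X * N := by rw [hMdef, unarySeries_eq, h1, map_one]
  have hT := unarySeries_gapSum φ y (fun _ => c + 1) φ
  set T := unarySeries y fun u => gapSum φ u (fun _ => c + 1) φ with hTdef
  have hne : X * (1 - X * M) ≠ 0 := by
    refine mul_ne_zero X_ne_zero fun h => ?_
    simpa using congrArg constantCoeff h
  have hTN : N = T := by
    refine mul_left_cancel₀ hne ?_
    rw [← hMdef, map_add, map_one] at hT
    linear_combination hM - X * hT - (1 - X * M) * hMN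
  have := eq_of_gapSum_eq φ h1 {y} (K := fun u => R (y :: u)) (L := fun _ => c + 1)
    (fun w hw => ?_) (List.replicate k y) fun x hx => List.eq_of_mem_replicate hx
  · simpa [List.replicate_succ] using this
  · rw [← hF]
    have hw' : w = List.replicate w.length y := List.eq_replicate_of_mem hw
    rw [hw']
    simpa [hN, hTdef, unarySeries] using congrArg (coeff w.length) hTN

theorem cumulant_eq_catalan {y : A} {c : ℂ} (hc : c ≠ 0) (hy : φ [y] = 1 / c)
    (hN : C c * unarySeries y (fun u => φ (y :: u)) = 1 +
      X * unarySeries y (fun u => φ (y :: u)) + X * unarySeries y (fun u => φ (y :: u)) ^ 2)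
    (k : ℕ) : R (List.replicate (k + 1) y) = catalan k / c ^ (2 * k + 1) := by
  have hr : R [y] = 1 / c := by rw [← hy, hF y []]; simp [gapSum, h1]
  have hrec : ∀ k, c * R (List.replicate (k + 2) y) = ∑ i ∈ Finset.range (k + 1),
      R (List.replicate (i + 1) y) * R (List.replicate (k - i + 1) y) := by
    intro k
    set N := unarySeries y fun u => φ (y :: u) with hNdef
    set P := unarySeries y φ with hP
    have hPN : P = 1 + X * N := by rw [hP, unarySeries_eq, h1, map_one]
    set T₁ := unarySeries y fun u => gapSum φ u (fun v => R (y :: y :: v)) φ with hT₁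
    have e1 : N = C (1 / c) * P + X * (P * T₁) := by
      have := unarySeries_gapSum φ y (fun u => R (y :: u)) φ
      simp only [← hF, hr] at this
      exact this
    set T₂ := unarySeries y fun u => gapSum φ u
      (splitSum fun u v => R (y :: u) * R (y :: v)) φ with hT₂
    have e2 : T₂ = C (1 / c) * N + X * (N * T₁) := by
      have := unarySeries_gapSum φ y (fun u => R (y :: u)) fun u => φ (y :: u)
      simp only [hr] at this
      rw [← this, hT₂]
      congr 1
      ext u
      simp only [hF y]
      rw [gapSum_gapSum]
    have hcc : C c * C (1 / c) = 1 := by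
      rw [← map_mul, mul_one_div_cancel hc, map_one]
    have hne : X * P ≠ 0 := by
      refine mul_ne_zero X_ne_zero fun h => ?_
      simpa [hPN] using congrArg constantCoeff h
    have hT : C c * T₁ = T₂ := by
      refine mul_left_cancel₀ hne ?_
      linear_combination -C c * e1 + hN - P * hcc - X * P * e2 + X * N * e1 - hPN
    have := eq_of_gapSum_eq φ h1 {y} (K := fun u => c * R (y :: y :: u))
      (L := splitSum fun u v => R (y :: u) * R (y :: v))
      (fun w hw => ?_) (List.replicate k y) fun x hx => List.eq_of_mem_replicate hx
    · simpa [splitSum_replicate, List.replicate_succ] using this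
    · have hw' : w = List.replicate w.length y := List.eq_replicate_of_mem hw
      rw [gapSum_mul_left, hw']
      simpa [hT₁, hT₂, unarySeries] using congrArg (coeff w.length) hT
  induction k using Nat.strong_induction_on with
  | _ k ih =>
    rcases k with _ | k
    · simpa using hr
    · refine mul_left_cancel₀ hc ?_
      rw [hrec k, catalan_div_recursion hc]
      refine Finset.sum_congr rfl fun i hi => ?_
      rw [Finset.mem_range] at hi
      rw [ih i (by omega), ih (k - i) (by omega)]

end UnaryWords

section InverseMoments

open MeasureTheory

theorem integrable_of_ae_mem_Icc {μ : Measure ℝ} [IsFiniteMeasure μ] {a b : ℝ}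
    (hμ : ∀ᵐ t ∂μ, t ∈ Set.Icc a b) {g : ℝ → ℝ} (hg : Measurable g)
    (hc : ContinuousOn g (Set.Icc a b)) : Integrable g μ := by
  obtain ⟨C, hC⟩ := isCompact_Icc.exists_bound_of_continuousOn hc
  exact Integrable.of_bound hg.aestronglyMeasurable C (hμ.mono hC)

theorem IsState.sq_le {A : Type*} [Ring A] [StarRing A] [Module ℂ A] [StarModule ℂ A]
    [IsScalarTower ℂ A A] [SMulCommClass ℂ A A] {φ : A →ₗ[ℂ] ℂ} (hφ : IsState φ) {y z : A}
    (hy : IsSelfAdjoint y) (hz : IsSelfAdjoint z) (hyz : y * z = z * y) {s : ℝ}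
    (hs : φ (z * z) = s) : ∃ r t : ℝ, φ (y * y) = t ∧ φ (y * z) = r ∧ r ^ 2 ≤ t * s := by
  have hpos : ∀ c : ℝ, ∃ r : ℝ, 0 ≤ r ∧
      φ (y * y) + 2 * c * φ (y * z) + c ^ 2 * φ (z * z) = r := by
    intro c
    obtain ⟨r, hr, h⟩ := hφ.2 (y + (c : ℂ) • z)
    refine ⟨r, hr, h ▸ ?_⟩
    rw [star_add, star_smul, hy.star_eq, hz.star_eq]
    simp only [add_mul, mul_add, smul_mul_assoc, mul_smul_comm, map_add, map_smul, smul_eq_mul,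
      ← hyz, RCLike.star_def, Complex.conj_ofReal]
    ring
  obtain ⟨t, -, ht⟩ := hpos 0
  obtain ⟨u, -, hu⟩ := hpos 1
  have ht : φ (y * y) = t := by simpa using ht
  have hr : φ (y * z) = ((u - t - s) / 2 : ℝ) := by
    rw [hs, ht] at hu
    push_cast at hu ⊢
    linear_combination hu / 2
  refine ⟨_, t, ht, hr, ?_⟩
  set r := (u - t - s) / 2
  have h := discrim_le_zero (a := s) (b := 2 * r) (c := t) fun c => by
    obtain ⟨v, hv, h⟩ := hpos c
    rw [ht, hr, hs] at h
    have : t + 2 * c * r + c ^ 2 * s = v := by exact_mod_cast h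
    nlinarith
  rw [discrim] at h
  nlinarith

theorem moments_inverse {A : Type*} [Ring A] [StarRing A] [Algebra ℂ A] [StarModule ℂ A]
    {φ : A →ₗ[ℂ] ℂ} (hφ : IsState φ) {X Y : A} (hX : IsSelfAdjoint X) (hY : IsSelfAdjoint Y)
    (hXY : X * Y = 1) (hYX : Y * X = 1) {μ : Measure ℝ} [IsFiniteMeasure μ] {a b : ℝ} (ha : 0 < a)
    (hab : a < b) (hμ : ∀ᵐ t ∂μ, t ∈ Set.Icc a b) (hmom : HasMoments φ X μ) (k : ℕ) :
    φ (Y ^ k) = ((∫ t, (t ^ k)⁻¹ ∂μ : ℝ) : ℂ) := by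
  have hb : 0 < b := ha.trans hab
  have hcomm : Commute X Y := hXY.trans hYX.symm
  set q : A := 1 - ((b⁻¹ : ℝ) : ℂ) • X with hq
  have hqX : Commute q X := (Commute.one_left X).sub_left ((Commute.refl X).smul_left _)
  have hqY : Commute q Y := (Commute.one_left Y).sub_left (hcomm.smul_left _)
  have hqs : IsSelfAdjoint q := by
    rw [hq, IsSelfAdjoint, star_sub, star_one, star_smul, hX.star_eq, RCLike.star_def,
      Complex.conj_ofReal]
  let g : ℕ → ℕ → ℕ → ℝ → ℝ := fun k i N t => (t ^ k)⁻¹ * t ^ i * (1 - b⁻¹ * t) ^ N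
  have hg : ∀ k i N, Integrable (g k i N) μ := by
    intro k i N
    refine integrable_of_ae_mem_Icc hμ (by fun_prop) ?_
    refine ContinuousOn.mul (ContinuousOn.mul ?_ (by fun_prop)) (by fun_prop)
    exact ContinuousOn.inv₀ (by fun_prop) fun t ht => (pow_pos (ha.trans_le ht.1) k).ne'
  let D : ℕ → ℕ → ℕ → ℂ := fun k i N => φ (Y ^ k * X ^ i * q ^ N) - ((∫ t, g k i N t ∂μ : ℝ) : ℂ)
  have hD : ∀ k i N, D k i (N + 1) = D k i N - (b⁻¹ : ℝ) * D k (i + 1) N := by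
    intro k i N
    have e1 : Y ^ k * X ^ i * q ^ (N + 1) =
        Y ^ k * X ^ i * q ^ N - ((b⁻¹ : ℝ) : ℂ) • (Y ^ k * X ^ (i + 1) * q ^ N) := by
      rw [pow_succ' q, pow_succ X]
      nth_rw 1 [hq]
      simp only [sub_mul, mul_sub, mul_assoc, one_mul, smul_mul_assoc, mul_smul_comm]
    have e2 : ∫ t, g k i (N + 1) t ∂μ =
        ∫ t, g k i N t ∂μ - b⁻¹ * ∫ t, g k (i + 1) N t ∂μ := by
      rw [← integral_const_mul, ← integral_sub (hg _ _ _) ((hg _ _ _).const_mul _)]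
      refine integral_congr_ae (Filter.Eventually.of_forall fun t => ?_)
      simp only [g]
      ring
    simp only [D, e1, e2, map_sub, map_smul, smul_eq_mul]
    push_cast
    ring
  have hD0 : ∀ k, (∀ i, D k i 0 = 0) → ∀ N i, D k i N = 0 := by
    intro k h N
    induction N with
    | zero => exact h
    | succ N ih => intro i; rw [hD, ih, ih, mul_zero, sub_zero]
  have hD1 : ∀ k, (∀ i, D k (i + 1) 0 = 0) → ∀ N, D k 0 N = D k 0 0 ∧ ∀ i, D k (i + 1) N = 0 := by
    intro k h N
    induction N with
    | zero => exact ⟨rfl, h⟩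
    | succ N ih =>
      refine ⟨?_, fun i => ?_⟩
      · rw [hD, ih.2, mul_zero, sub_zero, ih.1]
      · rw [hD, ih.2, ih.2, mul_zero, sub_zero]
  have hbase : ∀ i, D 0 i 0 = 0 := by
    intro i
    simp [D, g, hmom i]
  set θ := 1 - b⁻¹ * a with hθ
  have hab' : b⁻¹ * a < 1 := by rwa [inv_mul_lt_one₀ hb]
  have hθ0 : 0 < θ := by linarith
  have hθ1 : θ < 1 := by
    have : 0 < b⁻¹ * a := by positivity
    linarith
  have hbd : ∀ k N, 0 ≤ ∫ t, g k 0 N t ∂μ ∧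
      ∫ t, g k 0 N t ∂μ ≤ θ ^ N * ∫ t, g k 0 0 t ∂μ := by
    intro k N
    have h1 : ∀ᵐ t ∂μ, 0 ≤ g k 0 N t ∧ g k 0 N t ≤ θ ^ N * g k 0 0 t := by
      filter_upwards [hμ] with t ht
      have ht0 : 0 < t := ha.trans_le ht.1
      have h2 : b⁻¹ * t ≤ 1 := by rw [inv_mul_le_one₀ hb]; exact ht.2
      have h3 : b⁻¹ * a ≤ b⁻¹ * t := mul_le_mul_of_nonneg_left ht.1 (by positivity)
      have h4 : (1 - b⁻¹ * t) ^ N ≤ θ ^ N := pow_le_pow_left₀ (by linarith) (by linarith) N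
      have h5 : 0 ≤ (1 - b⁻¹ * t) ^ N := pow_nonneg (by linarith) N
      have h6 : 0 ≤ (t ^ k)⁻¹ := by positivity
      simp only [g, pow_zero, mul_one]
      exact ⟨mul_nonneg h6 h5, by rw [mul_comm]; exact mul_le_mul_of_nonneg_right h4 h6⟩
    refine ⟨integral_nonneg_of_ae (h1.mono fun t ht => ht.1), ?_⟩
    rw [← integral_const_mul]
    exact integral_mono_ae (hg _ _ _) ((hg _ _ _).const_mul _) (h1.mono fun t ht => ht.2)
  have key : ∀ k i, D k i 0 = 0 := by
    intro k
    induction k with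
    | zero => exact hbase
    | succ k ih =>
      have hstep : ∀ i, D (k + 1) (i + 1) 0 = 0 := by
        intro i
        rw [← ih i]
        have e1 : Y ^ (k + 1) * X ^ (i + 1) = Y ^ k * X ^ i := by
          rw [pow_succ Y, pow_succ' X, mul_assoc, ← mul_assoc Y, hYX, one_mul]
        have e2 : ∫ t, g (k + 1) (i + 1) 0 t ∂μ = ∫ t, g k i 0 t ∂μ := by
          refine integral_congr_ae ?_
          filter_upwards [hμ] with t ht
          have ht0 : t ≠ 0 := (ha.trans_le ht.1).ne'
          simp only [g]
          field_simp
          ring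
        simp only [D, e1, e2]
      rintro (_ | i)
      swap
      · exact hstep i
      obtain ⟨t, ht⟩ : ∃ t : ℝ, φ (Y ^ (k + 1) * Y ^ (k + 1)) = t := by
        obtain ⟨t, -, ht⟩ := hφ.2 (Y ^ (k + 1))
        exact ⟨t, by rwa [star_pow, hY.star_eq] at ht⟩
      have hmain : ∀ N : ℕ, ‖D (k + 1) 0 0‖ ≤
          θ ^ N * (Real.sqrt (t * ∫ t, g 0 0 0 t ∂μ) + ∫ t, g (k + 1) 0 0 t ∂μ) := by
        intro N
        rw [← (hD1 _ hstep N).1]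
        have hzz : φ (q ^ N * q ^ N) = ((∫ t, g 0 0 (N + N) t ∂μ : ℝ) : ℂ) := by
          have := hD0 0 hbase (N + N) 0
          simp only [D, pow_zero, one_mul, sub_eq_zero] at this
          rw [← pow_add, this]
        obtain ⟨r, t', ht', hr, hrt⟩ := hφ.sq_le (hY.pow (k + 1)) (hqs.pow N)
          ((hqY.pow_pow N (k + 1)).eq.symm) hzz
        obtain rfl : t' = t := by
          rw [ht] at ht'
          exact_mod_cast ht'.symm
        have ht0 : 0 ≤ t' := by
          obtain ⟨s, hs, hs'⟩ := hφ.2 (Y ^ (k + 1))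
          rw [star_pow, hY.star_eq, ht] at hs'
          have : t' = s := by exact_mod_cast hs'
          exact this ▸ hs
        have h1 : |r| ≤ θ ^ N * Real.sqrt (t' * ∫ t, g 0 0 0 t ∂μ) := by
          rw [← Real.sqrt_sq_eq_abs, ← Real.sqrt_sq (pow_nonneg hθ0.le N),
            ← Real.sqrt_mul (sq_nonneg _)]
          refine Real.sqrt_le_sqrt (hrt.trans ?_)
          have := mul_le_mul_of_nonneg_left (hbd 0 (N + N)).2 ht0
          rw [pow_add] at this
          linarith
        have h2 : |∫ t, g (k + 1) 0 N t ∂μ| ≤ θ ^ N * ∫ t, g (k + 1) 0 0 t ∂μ := by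
          rw [abs_of_nonneg (hbd _ _).1]
          exact (hbd _ _).2
        have h3 : D (k + 1) 0 N = ((r - ∫ t, g (k + 1) 0 N t ∂μ : ℝ) : ℂ) := by
          simp only [D, pow_zero, mul_one]
          rw [hr]
          push_cast
          rfl
        rw [h3, Complex.norm_real, Real.norm_eq_abs, mul_add]
        exact (abs_sub _ _).trans (add_le_add h1 h2)
      have hlim : Filter.Tendsto (fun N : ℕ =>
          θ ^ N * (Real.sqrt (t * ∫ t, g 0 0 0 t ∂μ) + ∫ t, g (k + 1) 0 0 t ∂μ))
          Filter.atTop (nhds 0) := by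
        simpa using (tendsto_pow_atTop_nhds_zero_of_lt_one hθ0.le hθ1).mul_const _
      exact norm_le_zero_iff.mp (ge_of_tendsto' hlim hmain)
  have := key k 0
  simpa [D, g, sub_eq_zero] using this

end InverseMoments

section MarchenkoPastur

open MeasureTheory

variable {l : ℝ} (hl : 1 < l)
include hl

/-- The quadratic under the square root in the Marchenko-Pastur density factors over the support. -/
theorem density_radicand_eq (x : ℝ) : 4 * l * 1 ^ 2 - (x - 1 * (1 + l)) ^ 2 =
    (x - (√l - 1) ^ 2) * ((√l + 1) ^ 2 - x) := by
  have := Real.sq_sqrt (show 0 ≤ l by linarith)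
  set s := √l
  rw [← this]
  ring

theorem edge_pos : 0 < (√l - 1) ^ 2 := by
  have : 1 < √l := Real.lt_sqrt_of_sq_lt (by simpa using hl)
  exact pow_pos (by linarith) 2

theorem edge_lt : (√l - 1) ^ 2 < (√l + 1) ^ 2 := by
  have : 1 < √l := Real.lt_sqrt_of_sq_lt (by simpa using hl)
  nlinarith

theorem freePoissonDensity_nonpos_of_notMem {x : ℝ}
    (hx : x ∉ Set.Icc ((√l - 1) ^ 2) ((√l + 1) ^ 2)) : freePoissonDensity l 1 x = 0 := by
  have h := edge_lt hl
  rw [freePoissonDensity, density_radicand_eq hl, Real.sqrt_eq_zero_of_nonpos, zero_div]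
  rw [Set.mem_Icc, not_and_or, not_le, not_le] at hx
  rcases hx with hx | hx <;> nlinarith

theorem freePoissonDensity_nonneg (x : ℝ) : 0 ≤ freePoissonDensity l 1 x := by
  by_cases hx : x ∈ Set.Icc ((√l - 1) ^ 2) ((√l + 1) ^ 2)
  · have : 0 < x := (edge_pos hl).trans_le hx.1
    rw [freePoissonDensity]
    positivity
  · exact (freePoissonDensity_nonpos_of_notMem hl hx).ge

theorem freePoissonMeasure_eq : freePoissonMeasure l 1 =
    volume.withDensity fun x => ENNReal.ofReal (freePoissonDensity l 1 x) := by
  rw [freePoissonMeasure, max_eq_left (by linarith), ENNReal.ofReal_zero, zero_smul, zero_add]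

omit hl in
theorem measurable_freePoissonDensity : Measurable (freePoissonDensity l 1) := by
  unfold freePoissonDensity
  fun_prop

theorem ae_mem_support :
    ∀ᵐ t ∂freePoissonMeasure l 1, t ∈ Set.Icc ((√l - 1) ^ 2) ((√l + 1) ^ 2) := by
  rw [freePoissonMeasure_eq hl, ae_withDensity_iff measurable_freePoissonDensity.ennreal_ofReal]
  refine Filter.Eventually.of_forall fun x hx => ?_
  by_contra h
  exact hx (by rw [freePoissonDensity_nonpos_of_notMem hl h, ENNReal.ofReal_zero])

theorem integral_freePoissonMeasure (g : ℝ → ℝ) : ∫ t, g t ∂freePoissonMeasure l 1 =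
    ∫ t in (√l - 1) ^ 2..(√l + 1) ^ 2, freePoissonDensity l 1 t * g t := by
  rw [freePoissonMeasure_eq hl, integral_withDensity_eq_integral_toReal_smul
    measurable_freePoissonDensity.ennreal_ofReal
    (Filter.Eventually.of_forall fun _ => ENNReal.ofReal_lt_top),
    intervalIntegral.integral_of_le (edge_lt hl).le, ← integral_Icc_eq_integral_Ioc,
    setIntegral_eq_integral_of_forall_compl_eq_zero]
  · refine integral_congr_ae (Filter.Eventually.of_forall fun t => ?_)
    simp only [ENNReal.toReal_ofReal (freePoissonDensity_nonneg hl t), smul_eq_mul]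
  · intro x hx
    rw [freePoissonDensity_nonpos_of_notMem hl hx, zero_mul]

/-- Integer moments of the Marchenko-Pastur law. -/
theorem moment_recursion (k : ℤ) :
    ((k : ℝ) + 3) * ∫ t, t ^ (k + 2) ∂freePoissonMeasure l 1 =
      (2 * k + 3) * (1 + l) * ∫ t, t ^ (k + 1) ∂freePoissonMeasure l 1 -
        k * (l - 1) ^ 2 * ∫ t, t ^ k ∂freePoissonMeasure l 1 := by
  have ha := edge_pos hl
  have hab := edge_lt hl
  simp only [integral_freePoissonMeasure hl]
  set a := (√l - 1) ^ 2
  set b := (√l + 1) ^ 2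
  let Q : ℝ → ℝ := fun x => 4 * l * 1 ^ 2 - (x - 1 * (1 + l)) ^ 2
  have hQ : ∀ x, Q x = (x - a) * (b - x) := density_radicand_eq hl
  have hcont : ∀ j : ℤ, ContinuousOn (fun t => freePoissonDensity l 1 t * t ^ j)
      (Set.Icc a b) := by
    intro j
    unfold freePoissonDensity
    refine ContinuousOn.mul (ContinuousOn.div (by fun_prop) (by fun_prop) fun t ht => ?_)
      (continuousOn_id.zpow₀ _ fun t ht => Or.inl (ha.trans_le ht.1).ne')
    have := ha.trans_le ht.1
    positivity
  have h_inter : ∀ j : ℤ, IntervalIntegrable (fun t => freePoissonDensity l 1 t * t ^ j)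
      volume a b := fun j => (by
        rw [← Set.uIcc_of_le hab.le] at hcont
        exact (hcont j).intervalIntegrable)
  have hderiv : ∀ x ∈ Set.Ioo a b, HasDerivAt (fun t => t ^ k * (Q t * √(Q t)) / (2 * Real.pi))
      (-((k : ℝ) + 3) * (freePoissonDensity l 1 x * x ^ (k + 2)) +
        (2 * k + 3) * (1 + l) * (freePoissonDensity l 1 x * x ^ (k + 1)) -
        k * (l - 1) ^ 2 * (freePoissonDensity l 1 x * x ^ k)) x := by
    intro x hx
    have hx0 : x ≠ 0 := (ha.trans hx.1).ne'
    have hQx : 0 < Q x := by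
      rw [hQ]
      exact mul_pos (by linarith [hx.1]) (by linarith [hx.2])
    have hQ' : HasDerivAt Q (-(2 * (x - (1 + l)))) x := by
      have h := ((((hasDerivAt_id x).sub_const (1 * (1 + l))).pow 2).const_sub (4 * l * 1 ^ 2))
      refine h.congr_deriv ?_
      simp
    have h := (((hasDerivAt_zpow k x (Or.inl hx0)).mul (hQ'.mul (hQ'.sqrt hQx.ne'))).div_const
      (2 * Real.pi))
    refine h.congr_deriv ?_
    have hs : √(Q x) ≠ 0 := (Real.sqrt_pos.mpr hQx).ne'
    have hss : √(Q x) ^ 2 = Q x := Real.sq_sqrt hQx.le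
    have hd : freePoissonDensity l 1 x = √(Q x) / (2 * Real.pi * 1 * x) := rfl
    have hQe : Q x = 4 * l * 1 ^ 2 - (x - 1 * (1 + l)) ^ 2 := rfl
    rw [hd, zpow_add₀ hx0, zpow_add₀ hx0, zpow_sub₀ hx0]
    rw [Pi.mul_apply]
    generalize √(Q x) = r at hs hss ⊢
    have hpi := Real.pi_ne_zero
    have e : Q x * (-(2 * (x - (1 + l))) / (2 * r)) = -(x - (1 + l)) * r := by
      rw [← hss]
      field_simp
    rw [e, hQe]
    norm_num
    field_simp
    ring
  have hcontF : ContinuousOn (fun t => t ^ k * (Q t * √(Q t)) / (2 * Real.pi)) (Set.Icc a b) := by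
    refine ContinuousOn.div_const (ContinuousOn.mul
      (continuousOn_id.zpow₀ _ fun t ht => Or.inl (ha.trans_le ht.1).ne') ?_) _
    fun_prop
  have hFTC := intervalIntegral.integral_eq_sub_of_hasDerivAt_of_le hab.le hcontF hderiv
    ((((h_inter _).const_mul _).add ((h_inter _).const_mul _)).sub ((h_inter _).const_mul _))
  rw [intervalIntegral.integral_sub (((h_inter _).const_mul _).add ((h_inter _).const_mul _))
    ((h_inter _).const_mul _), intervalIntegral.integral_add ((h_inter _).const_mul _)
    ((h_inter _).const_mul _), intervalIntegral.integral_const_mul,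
    intervalIntegral.integral_const_mul, intervalIntegral.integral_const_mul, hQ, hQ] at hFTC
  simp only [sub_self, mul_zero, zero_mul, zero_div] at hFTC
  linarith

theorem first_moment : ∫ t, t ∂freePoissonMeasure l 1 = l := by
  have ha := edge_pos hl
  have hab := edge_lt hl
  have hl0 : 0 < √l := Real.sqrt_pos.mpr (by linarith)
  have hll := Real.sq_sqrt (show 0 ≤ l by linarith)
  rw [integral_freePoissonMeasure hl]
  have h1 : ∫ t in (√l - 1) ^ 2..(√l + 1) ^ 2, freePoissonDensity l 1 t * t =
      ∫ t in (√l - 1) ^ 2..(√l + 1) ^ 2,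
        (√l / Real.pi) * √(1 - (t / (2 * √l) - (1 + l) / (2 * √l)) ^ 2) := by
    refine intervalIntegral.integral_congr fun t ht => ?_
    rw [Set.uIcc_of_le hab.le] at ht
    have ht0 : t ≠ 0 := (ha.trans_le ht.1).ne'
    have e : 4 * l * 1 ^ 2 - (t - 1 * (1 + l)) ^ 2 =
        (2 * √l) ^ 2 * (1 - (t / (2 * √l) - (1 + l) / (2 * √l)) ^ 2) := by
      field_simp
      nlinarith
    simp only [freePoissonDensity]
    rw [e, Real.sqrt_mul (by positivity), Real.sqrt_sq (by positivity)]
    have hpi := Real.pi_ne_zero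
    field_simp
  rw [h1, intervalIntegral.integral_const_mul,
    intervalIntegral.integral_comp_div_sub (fun u => √(1 - u ^ 2)) (by positivity)]
  have e1 : (√l - 1) ^ 2 / (2 * √l) - (1 + l) / (2 * √l) = -1 := by
    field_simp
    nlinarith
  have e2 : (√l + 1) ^ 2 / (2 * √l) - (1 + l) / (2 * √l) = 1 := by
    field_simp
    nlinarith
  rw [e1, e2, integral_sqrt_one_sub_sq, smul_eq_mul]
  have hpi := Real.pi_ne_zero
  field_simp
  nlinarith

end MarchenkoPastur

section FreePoissonElement

open MeasureTheory

theorem isProbabilityMeasure_of_hasMoments {A : Type*} [Monoid A] {φ : A → ℂ} {X : A}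
    {μ : Measure ℝ} (h : HasMoments φ X μ) (h1 : φ 1 = 1) : IsProbabilityMeasure μ := by
  have h0 := h 0
  simp only [pow_zero, h1, integral_const, smul_eq_mul, mul_one] at h0
  have h0' : (μ Set.univ).toReal = 1 := by
    rw [← measureReal_def]
    exact_mod_cast h0.symm
  exact ⟨(ENNReal.toReal_eq_one_iff _).mp h0'⟩

variable {l : ℝ} (hl : 1 < l)
include hl

theorem freePoisson_inverse_moment [IsProbabilityMeasure (freePoissonMeasure l 1)] (k : ℕ) :
    ∫ t, (t ^ (k + 1))⁻¹ ∂freePoissonMeasure l 1 =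
      (∫ t, t ^ k ∂freePoissonMeasure l 1) / (l - 1) ^ (2 * k + 1) := by
  have hrec := moment_recursion hl
  have hl1 : l - 1 ≠ 0 := by linarith
  let I : ℤ → ℝ := fun j => ∫ t, t ^ j ∂freePoissonMeasure l 1
  have hrec : ∀ k : ℤ, ((k : ℝ) + 3) * I (k + 2) =
      (2 * k + 3) * (1 + l) * I (k + 1) - k * (l - 1) ^ 2 * I k := hrec
  have hneg : ∀ k : ℕ, ∫ t, (t ^ (k + 1))⁻¹ ∂freePoissonMeasure l 1 = I (-(k + 1)) := by
    intro k
    refine integral_congr_ae (Filter.Eventually.of_forall fun t => ?_)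
    simp only
    rw [zpow_neg]
    norm_cast
  have hpos : ∀ k : ℕ, ∫ t, t ^ k ∂freePoissonMeasure l 1 = I k := by
    intro k
    refine integral_congr_ae (Filter.Eventually.of_forall fun t => ?_)
    simp
  rw [hneg, hpos]
  have h0 : I 0 = 1 := by simp [I]
  have h1 : I 1 = l := by simpa [I] using first_moment hl
  have hm1 : I (-1) = 1 / (l - 1) := by
    have := hrec (-1)
    norm_num [h0, h1] at this
    field_simp
    refine mul_left_cancel₀ hl1 ?_
    linarith
  induction k using Nat.strong_induction_on with
  | _ k ih =>
    rcases k with _ | _ | k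
    · simpa [h0] using hm1
    · have := hrec (-2)
      norm_num [h0, h1, hm1] at this ⊢
      field_simp at this ⊢
      linarith
    · have e0 := ih k (by omega)
      have e1 := ih (k + 1) (by omega)
      have r1 := hrec k
      have r2 := hrec (-(k + 3))
      rw [show -((k : ℤ) + 3) + 2 = -(k + 1) by ring,
        show -((k : ℤ) + 3) + 1 = -((k + 1 : ℕ) + 1) by push_cast; ring, e0, e1] at r2
      push_cast at r1 r2 ⊢
      rw [show -((k : ℤ) + 1 + 1 + 1) = -(k + 3) by ring,
        show (k : ℤ) + 1 + 1 = k + 2 by ring]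
      have hk : (k : ℝ) + 3 ≠ 0 := by positivity
      refine mul_left_cancel₀ (mul_ne_zero hk (pow_ne_zero 2 hl1)) ?_
      have : ((k : ℝ) + 3) * (l - 1) ^ 2 * (I (k + 2) / (l - 1) ^ (2 * (k + 1 + 1) + 1)) =
          (((k : ℝ) + 3) * I (k + 2)) / (l - 1) ^ (2 * (k + 1) + 1) := by
        field_simp
        ring
      rw [this, r1]
      have hlast : ((k : ℝ) + 3) * (l - 1) ^ 2 * I (-(k + 3)) =
          (2 * k + 3) * (1 + l) * (I (k + 1) / (l - 1) ^ (2 * (k + 1) + 1)) -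
            k * (I k / (l - 1) ^ (2 * k + 1)) := by linarith
      rw [hlast]
      field_simp
      ring

variable {A : Type*} [Ring A] [StarRing A] [Algebra ℂ A] [StarModule ℂ A] {φ : A →ₗ[ℂ] ℂ}
  {R : ∀ n, (Fin n → A) → ℂ} (hst : IsState φ) (hmc : MomentCumulant (⇑φ) R) {X Y : A}
  (hX : IsSelfAdjoint X) (hY : IsSelfAdjoint Y) (hXY : X * Y = 1) (hYX : Y * X = 1)
  (hmom : HasMoments (⇑φ) X (freePoissonMeasure l 1))
include hst hmc hmom

omit hmc [StarModule ℂ A] in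
theorem freePoisson_moment_quadratic :
    PowerSeries.mk (fun k => φ (X ^ k)) =
      1 + PowerSeries.C ((l : ℂ) - 1) * PowerSeries.X * PowerSeries.mk (fun k => φ (X ^ k)) +
        PowerSeries.X * PowerSeries.mk (fun k => φ (X ^ k)) ^ 2 := by
  refine marchenkoPastur_quadratic (by simp [hst.1]) ?_ fun k => ?_
  · rw [hmom 1]
    simp [first_moment hl]
  · have := moment_recursion hl k
    rw [hmom, hmom, hmom]
    norm_cast
    push_cast at this ⊢
    norm_cast at this ⊢
    push_cast at this ⊢
    linarith

omit [StarModule ℂ A] in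
theorem freePoisson_cumulant (k : ℕ) : listCum R (List.replicate (k + 1) X) = l := by
  have h := cumulant_eq_of_unarySeries (φ := fun u => φ u.prod) (R := listCum R) (y := X)
    (c := (l : ℂ) - 1) (by simp [hst.1]) hmc.prod_cons ?_ k
  · rw [h]
    ring
  · simpa [unarySeries] using freePoisson_moment_quadratic hl hst hmom

include hX hY hXY hYX

theorem freePoisson_inverse_cumulant (k : ℕ) :
    listCum R (List.replicate (k + 1) Y) = catalan k / ((l : ℂ) - 1) ^ (2 * k + 1) := by
  have hprob := isProbabilityMeasure_of_hasMoments hmom hst.1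
  have hc : (l : ℂ) - 1 ≠ 0 := by
    intro h
    have : l - 1 = 0 := by exact_mod_cast h
    linarith
  have hYk : ∀ k : ℕ, φ (Y ^ (k + 1)) = φ (X ^ k) / ((l : ℂ) - 1) ^ (2 * k + 1) := by
    intro k
    rw [moments_inverse hst hX hY hXY hYX (edge_pos hl) (edge_lt hl) (ae_mem_support hl) hmom,
      freePoisson_inverse_moment hl, hmom]
    push_cast
    rfl
  refine cumulant_eq_catalan (φ := fun u => φ u.prod) (by simp [hst.1]) hmc.prod_cons hc ?_ ?_ k
  · simpa [hst.1] using hYk 0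
  · have hq := freePoisson_moment_quadratic hl hst hmom
    have hser : unarySeries Y (fun u => φ (Y :: u).prod) =
        PowerSeries.mk fun k => φ (X ^ k) / ((l : ℂ) - 1) ^ (2 * k + 1) := by
      ext k
      rw [PowerSeries.coeff_mk, ← hYk, pow_succ']
      simp [unarySeries]
    rw [hser]
    generalize (l : ℂ) - 1 = c at hc hq ⊢
    ext k
    have hk := congrArg (PowerSeries.coeff k) hq
    rw [mul_assoc] at hk
    rcases k with _ | k
    · simp only [map_add, PowerSeries.coeff_C_mul, PowerSeries.coeff_zero_X_mul,
        PowerSeries.coeff_zero_one, PowerSeries.coeff_mk] at hk ⊢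
      rw [hk]
      field_simp
      ring
    · simp only [map_add, PowerSeries.coeff_C_mul, PowerSeries.coeff_succ_X_mul,
        PowerSeries.coeff_one, sq] at hk ⊢
      simp only [PowerSeries.coeff_mul, PowerSeries.coeff_mk] at hk ⊢
      have hsum : ∑ x ∈ Finset.HasAntidiagonal.antidiagonal k, φ (X ^ x.1) / c ^ (2 * x.1 + 1) *
          (φ (X ^ x.2) / c ^ (2 * x.2 + 1)) =
          (∑ x ∈ Finset.HasAntidiagonal.antidiagonal k, φ (X ^ x.1) * φ (X ^ x.2)) / c ^ (2 * k + 2) := by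
        rw [Finset.sum_div]
        refine Finset.sum_congr rfl fun x hx => ?_
        rw [div_mul_div_comm, ← pow_add, ← Finset.HasAntidiagonal.mem_antidiagonal.mp hx]
        congr 2
        ring
      rw [hsum, hk]
      field_simp
      simp
      ring

end FreePoissonElement

section MixedWords

/-- Words in which no two letters `false` are adjacent. -/
def NoAdjFalse (u : List Bool) : Prop := u.IsChain fun a b => (a || b) = true

theorem noAdjFalse_append_true_cons {u v : List Bool} :
    NoAdjFalse (u ++ true :: v) ↔ NoAdjFalse u ∧ NoAdjFalse v := by
  simp [NoAdjFalse, List.isChain_append, List.isChain_cons]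

theorem noAdjFalse_concat_true {u : List Bool} : NoAdjFalse (u ++ [true]) ↔ NoAdjFalse u := by
  rw [noAdjFalse_append_true_cons]
  simp [NoAdjFalse]

theorem noAdjFalse_replicate_true_append {j : ℕ} {v : List Bool} :
    NoAdjFalse (List.replicate j true ++ v) ↔ NoAdjFalse v := by
  induction j with
  | zero => simp
  | succ j ih =>
    rw [List.replicate_succ, List.cons_append, ← List.nil_append (true :: _),
      noAdjFalse_append_true_cons, ih]
    simp [NoAdjFalse]

theorem noAdjFalse_append_replicate_true {j : ℕ} {v : List Bool} :
    NoAdjFalse (v ++ List.replicate j true) ↔ NoAdjFalse v := by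
  induction j with
  | zero => simp
  | succ j ih => rw [List.replicate_succ', ← List.append_assoc, noAdjFalse_concat_true, ih]

theorem not_noAdjFalse_concat_false_false (u : List Bool) :
    ¬ NoAdjFalse (u ++ [false] ++ [false]) := by
  simp [NoAdjFalse, List.isChain_append]

/-- The value of the cumulant of the word `true :: u`. -/
def wordVal (r : ℕ → ℂ) (u : List Bool) : ℂ :=
  if NoAdjFalse u then (-1) ^ u.count false * r (u.count true) else 0

variable {r : ℕ → ℂ}

theorem wordVal_nil : wordVal r [] = r 0 := by simp [wordVal, NoAdjFalse]

theorem wordVal_concat_false_false (u : List Bool) : wordVal r (u ++ [false] ++ [false]) = 0 := by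
  rw [wordVal, if_neg (not_noAdjFalse_concat_false_false u)]

theorem wordVal_concat_true_false (u : List Bool) :
    wordVal r (u ++ [true] ++ [false]) = -wordVal r (u ++ [true]) := by
  have h : NoAdjFalse (u ++ [true] ++ [false]) ↔ NoAdjFalse (u ++ [true]) := by
    rw [noAdjFalse_concat_true, List.append_assoc, List.singleton_append,
      noAdjFalse_append_true_cons]
    simp [NoAdjFalse]
  simp only [wordVal, h, List.count_append]
  split_ifs
  · simp [pow_succ]
  · simp

theorem wordVal_singleton_false : wordVal r [false] = -r 0 := by simp [wordVal, NoAdjFalse]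

/-- The value of the cumulant of the word `false :: v`. -/
def falseWordVal (r : ℕ → ℂ) (c : ℂ) (v : List Bool) : ℂ :=
  if true ∈ v then if v.head? = some true then wordVal r (v.tail ++ [false]) else 0 else c + 1

theorem splitSum_count (g : ℕ → ℕ → ℂ) (w : List Bool) :
    splitSum (fun u v => if v.head? = some true then g (u.count true) (v.tail.count true) else 0) w =
      ∑ i ∈ Finset.range (w.count true), g i (w.count true - 1 - i) := by
  induction w generalizing g with
  | nil => simp [splitSum]
  | cons b w ih =>
    cases b
    · simpa [splitSum] using ih g
    · have h := ih fun i j => g (i + 1) j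
      simp only [splitSum, List.count_cons_self, List.head?_cons, List.tail_cons, if_true,
        List.count_nil, Finset.sum_range_succ', Nat.add_sub_cancel, Nat.sub_zero]
      rw [h, add_comm]
      congr 1
      refine Finset.sum_congr rfl fun i _ => ?_
      congr 1
      omega

variable {c : ℂ} (hr0 : c * r 0 = 1)
  (hr : ∀ k, c * r (k + 1) = ∑ i ∈ Finset.range (k + 1), r i * r (k - i))

include hr in
theorem splitSum_wordVal_mul (w : List Bool) (hw : true ∈ w) :
    splitSum (fun u v => if v.head? = some true then wordVal r u * wordVal r v.tail else 0) w =
      c * wordVal r w := by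
  have h : ∀ u v : List Bool, u ++ v = w →
      (if v.head? = some true then wordVal r u * wordVal r v.tail else 0) =
        (if NoAdjFalse w then (-1) ^ w.count false else 0) *
          if v.head? = some true then r (u.count true) * r (v.tail.count true) else 0 := by
    rintro u v rfl
    rcases v with _ | ⟨_ | _, v⟩
    · simp
    · simp
    · simp only [List.head?_cons, if_true, List.tail_cons, wordVal, noAdjFalse_append_true_cons,
        List.count_append]
      by_cases hu : NoAdjFalse u <;> by_cases hv : NoAdjFalse v <;> simp [hu, hv, pow_add]
      ring
  rw [splitSum_congr h, splitSum_const_mul, splitSum_count fun i j => r i * r j, wordVal]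
  obtain ⟨k, hk⟩ := Nat.exists_eq_add_one_of_ne_zero (List.count_pos_iff.mpr hw).ne'
  rw [hk]
  simp only [Nat.add_sub_cancel]
  rw [← hr k]
  split_ifs <;> ring

theorem splitSum_wordVal_all_false (w : List Bool) :
    splitSum (fun u v => if true ∈ v then 0 else wordVal r u) w = -wordVal r (w ++ [false]) := by
  induction w using List.reverseRecOn with
  | nil => simp [splitSum, wordVal_nil, wordVal_singleton_false]
  | append_singleton w x ih =>
    rw [splitSum_concat]
    cases x
    · have := wordVal_concat_false_false (r := r) w
      simp_all
    · simp only [List.mem_append, List.mem_singleton, or_true, if_true, splitSum_zero,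
        List.not_mem_nil, if_false, wordVal_concat_true_false]
      ring

include hr0 hr in
theorem splitSum_wordVal_mul_falseWordVal (w : List Bool) :
    splitSum (fun u v => wordVal r u * falseWordVal r c v) w =
      (if w = [] then 1 else 0) - wordVal r (w ++ [false]) := by
  rcases List.eq_nil_or_concat' w with rfl | ⟨w, x, rfl⟩
  · simp [splitSum, wordVal_nil, wordVal_singleton_false, falseWordVal]
    linear_combination hr0
  cases x
  · have h : ∀ u v : List Bool, u ++ v = w ++ [false] → wordVal r u * falseWordVal r c v =
        (c + 1) * if true ∈ v then 0 else wordVal r u := by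
      intro u v huv
      rcases List.eq_nil_or_concat' v with rfl | ⟨v, y, rfl⟩
      · simp [falseWordVal, mul_comm]
      · obtain rfl : y = false := by
          rw [← List.append_assoc] at huv
          exact (List.append_inj' huv rfl).2 |> List.singleton_inj.mp
        rcases v with _ | ⟨_ | _, v⟩
        · simp [falseWordVal, mul_comm]
        · simp only [falseWordVal]
          split_ifs <;> simp_all [mul_comm]
        · have := wordVal_concat_false_false (r := r) v
          simp_all [falseWordVal]
    rw [splitSum_congr h, splitSum_const_mul, splitSum_wordVal_all_false,
      wordVal_concat_false_false]
    simp
  · have h : ∀ u v : List Bool, u ++ v ++ [true] = w ++ [true] →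
        wordVal r u * falseWordVal r c (v ++ [true]) =
        -1 * if (v ++ [true]).head? = some true
          then wordVal r u * wordVal r (v ++ [true]).tail else 0 := by
      intro u v _
      rcases v with _ | ⟨_ | _, v⟩
      · simp [falseWordVal, wordVal_nil, wordVal_singleton_false]
      · simp [falseWordVal]
      · have := wordVal_concat_true_false (r := r) v
        simp only [List.append_assoc, List.cons_append, List.nil_append] at this
        simp [falseWordVal, this]
    have hsum := splitSum_wordVal_mul hr (w ++ [true]) (by simp)
    rw [splitSum_concat] at hsum ⊢
    rw [splitSum_congr fun u v huv => h u v (by rw [huv]), splitSum_const_mul,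
      wordVal_concat_true_false]
    simp only [List.head?_nil, reduceCtorEq, if_false, add_zero] at hsum
    rw [hsum]
    simp [falseWordVal]
    ring

theorem exists_eq_replicate_false_append {v : List Bool} (hv : true ∈ v) :
    ∃ i v', v = List.replicate i false ++ true :: v' := by
  induction v with
  | nil => simp at hv
  | cons b v ih =>
    cases b
    · obtain ⟨i, v', rfl⟩ := ih (by simpa using hv)
      exact ⟨i + 1, v', by simp [List.replicate_succ]⟩
    · exact ⟨0, v, rfl⟩

theorem exists_eq_append_replicate_true {u : List Bool} (hu : false ∈ u) :
    ∃ u' j, u = u' ++ false :: List.replicate j true := by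
  induction u using List.reverseRecOn with
  | nil => simp at hu
  | append_singleton u b ih =>
    cases b
    · exact ⟨u, 0, by simp⟩
    · obtain ⟨u', j, rfl⟩ := ih (by simpa using hu)
      exact ⟨u', j + 1, by simp [List.replicate_succ']⟩

include hr0 hr in
/-- A cyclically invariant function of words satisfying the cancellation recursion is determined
by its values on constant words. -/
theorem eq_wordVal {ρ : List Bool → ℂ} (hcomm : ∀ u v, ρ (u ++ v) = ρ (v ++ u))
    (hcancel : ∀ w, ρ (false :: true :: w) +
      splitSum (fun u v => ρ (true :: u) * ρ (false :: v)) w = if w = [] then 1 else 0)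
    (hfalse : ∀ k, ρ (List.replicate (k + 1) false) = c + 1)
    (htrue : ∀ k, ρ (List.replicate (k + 1) true) = r k) (u : List Bool) :
    ρ (true :: u) = wordVal r u := by
  induction hn : u.length using Nat.strong_induction_on generalizing u with
  | _ n ih =>
    by_cases hu : false ∈ u
    swap
    · have hu' : u = List.replicate u.length true := by
        refine List.eq_replicate_of_mem fun b hb => ?_
        cases b
        · exact absurd hb hu
        · rfl
      have h := htrue u.length
      rw [List.replicate_succ, ← hu'] at h
      have hg : NoAdjFalse u := by
        rw [hu', ← List.append_nil (List.replicate _ _), noAdjFalse_replicate_true_append]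
        simp [NoAdjFalse]
      rw [h, wordVal, if_pos hg, List.count_eq_zero_of_not_mem hu]
      nth_rw 2 [hu']
      simp
    obtain ⟨u, j, rfl⟩ := exists_eq_append_replicate_true hu
    have key : ∀ w : List Bool, w.length < n → ρ (false :: true :: w) = wordVal r (w ++ [false]) := by
      intro w hw
      have h := hcancel w
      have hs : splitSum (fun u v => ρ (true :: u) * ρ (false :: v)) w =
          splitSum (fun u v => wordVal r u * falseWordVal r c v) w := by
        refine splitSum_congr fun u v huv => ?_
        have hlen := congrArg List.length huv
        rw [List.length_append] at hlen
        congr 1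
        · exact ih u.length (by omega) u rfl
        · rw [falseWordVal]
          split_ifs with hv hv'
          · obtain ⟨v, rfl⟩ : ∃ v', v = true :: v' := by
              cases v <;> simp_all
            have hl : (v ++ [false]).length < n := by
              simp only [List.length_cons] at hlen
              simp only [List.length_append, List.length_singleton]
              omega
            rw [List.tail_cons, ← ih _ hl _ rfl, ← List.singleton_append, hcomm]
            simp
          · obtain ⟨i, v, rfl⟩ := exists_eq_replicate_false_append hv
            rcases i with _ | i
            · simp at hv'
            have hl : (v ++ List.replicate i false ++ [false] ++ [false]).length < n := by
              simp only [List.length_cons, List.length_append, List.length_replicate,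
                List.length_nil] at hlen ⊢
              omega
            have h := ih _ hl _ rfl
            rw [wordVal_concat_false_false] at h
            rw [← h, ← List.cons_append, hcomm]
            congr 1
            have hrep : false :: (List.replicate i false ++ [false]) =
                List.replicate i false ++ [false, false] := by
              rw [← List.replicate_succ', ← List.replicate_succ]
              simp [List.replicate_succ']
            simp [List.replicate_succ', hrep]
          · have hv' : v = List.replicate v.length false := by
              refine List.eq_replicate_of_mem fun b hb => ?_
              cases b
              · rfl
              · exact absurd hb hv
            have h := hfalse v.length
            rwa [List.replicate_succ, ← hv'] at h
      rw [hs, splitSum_wordVal_mul_falseWordVal hr0 hr] at h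
      linear_combination h
    have hrot : ρ (true :: (u ++ false :: List.replicate j true)) =
        ρ (false :: (List.replicate j true ++ true :: u)) := by
      rw [← List.cons_append, hcomm, List.cons_append]
    have hw : false :: (List.replicate j true ++ true :: u) =
        false :: true :: (List.replicate j true ++ u) := by
      rw [List.append_cons, ← List.replicate_succ', List.replicate_succ, List.cons_append]
    rw [hrot, hw, key _ (by simp at hn ⊢; omega)]
    have hg : NoAdjFalse (List.replicate j true ++ u ++ [false]) ↔
        NoAdjFalse (u ++ false :: List.replicate j true) := by
      rw [List.append_assoc, noAdjFalse_replicate_true_append,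
        List.append_cons u false (List.replicate j true), noAdjFalse_append_replicate_true]
    simp only [wordVal, hg]
    congr 2
    · simp [List.count_append, List.count_replicate]
    · simp [List.count_append, add_comm]

end MixedWords

theorem card_filter_eq_count_ofFn {n : ℕ} (w : Fin n → Bool) (b : Bool) :
    (Finset.univ.filter fun i => w i = b).card = (List.ofFn w).count b := by
  have h := Fin.card_filter_univ_eq_vector_get_eq_count b (List.Vector.ofFn w)
  simp only [List.Vector.get_ofFn, List.Vector.toList_ofFn] at h
  rw [← h]

theorem listCum_inverse_word {A : Type*} [Ring A] [StarRing A] [Algebra ℂ A] [StarModule ℂ A]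
    {φ : A →ₗ[ℂ] ℂ} {R : ∀ n, (Fin n → A) → ℂ} (hst : IsState φ) (htr : Tracial φ)
    (hmc : MomentCumulant (⇑φ) R) {X : A} (hXsa : IsSelfAdjoint X) (hU : IsUnit X) {l : ℝ}
    (hl : 1 < l) (hmom : HasMoments (⇑φ) X (freePoissonMeasure l 1)) (u : List Bool) :
    listCum R ((true :: u).map fun b => if b then Ring.inverse X else X) =
      wordVal (fun k => (catalan k : ℂ) / ((l : ℂ) - 1) ^ (2 * k + 1)) u := by
  have hc : (l : ℂ) - 1 ≠ 0 := by
    intro h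
    have : l - 1 = 0 := by exact_mod_cast h
    linarith
  have h1 : φ ([] : List A).prod = 1 := by simpa using hst.1
  refine eq_wordVal (c := (l : ℂ) - 1)
    (r := fun k => (catalan k : ℂ) / ((l : ℂ) - 1) ^ (2 * k + 1))
    (ρ := fun w => listCum R (w.map fun b => if b then Ring.inverse X else X))
    (by simp [hc]) (catalan_div_recursion hc) (fun u v => ?_) (fun w => ?_) (fun k => ?_)
    (fun k => ?_) u
  · simp only [List.map_append]
    exact cumulant_append_comm (fun u : List A => φ u.prod) h1 (listCum R) hmc.prod_cons
      hmc.prod_concat (fun x w => by simpa using htr x w.prod) _ _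
  · have h := cumulant_cancel (fun u : List A => φ u.prod) h1 (listCum R) hmc.prod_cons
      (a := X) (b := Ring.inverse X)
      (fun w => by simp [← mul_assoc, Ring.mul_inverse_cancel X hU])
      (w.map fun b => if b then Ring.inverse X else X)
    rw [splitSum_map] at h
    simpa using h
  · simpa using freePoisson_cumulant hl hst hmc hmom k
  · simpa using freePoisson_inverse_cumulant hl hst hmc hXsa hXsa.ringInverse
      (Ring.mul_inverse_cancel X hU) (Ring.inverse_mul_cancel X hU) hmom k

theorem noAdjFalse_ofFn {n : ℕ} {w : Fin n → Bool} :
    NoAdjFalse (List.ofFn w) ↔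
      ∀ j : Fin n, ∀ hj : j.1 + 1 < n, w j = false → w ⟨j.1 + 1, hj⟩ = true := by
  simp only [NoAdjFalse, List.isChain_iff_getElem, List.length_ofFn, List.getElem_ofFn]
  constructor
  · intro h j hj hw
    simpa [hw] using h j hj
  · intro h i hi
    cases hw : w ⟨i, by omega⟩
    · simpa using h ⟨i, by omega⟩ hi hw
    · simp

/-- joint cumulants of `X` and `X⁻¹` for `X` free Poisson with rate `l > 1`
and jump size `1`. A tuple starting with `X⁻¹` whose entries are `X` or `X⁻¹` (the positions
of `X⁻¹` are marked by `w i = true`) corresponds to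
`R(X⁻¹, X,…,X, X⁻¹, X,…,X, …)`; if two `X`'s are adjacent the cumulant vanishes, otherwise
it equals `(−1)^{#X's} · R_m(X⁻¹) = (−1)^{#X's} · C_{m-1}/(l−1)^{2m−1}`, `m = #X⁻¹'s`. -/
theorem freePoisson_joint_cumulants
    {A : Type*} [NormedRing A] [StarRing A] [CStarRing A] [CompleteSpace A]
    [NormedAlgebra ℂ A] [StarModule ℂ A]
    (φ : A →ₗ[ℂ] ℂ) (R : ∀ n, (Fin n → A) → ℂ)
    (hst : IsState φ) (hfa : Faithful φ) (htr : Tracial φ)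
    (hmc : MomentCumulant (⇑φ) R)
    (X : A) (hXsa : IsSelfAdjoint X) (hU : IsUnit X) (l : ℝ) (hl : 1 < l)
    (hmom : HasMoments (⇑φ) X (freePoissonMeasure l 1))
    (n : ℕ) (hn : 1 ≤ n) (w : Fin n → Bool) (h0 : w ⟨0, by omega⟩ = true)
    (f : Fin n → A) (hf : ∀ i, f i = if w i then Ring.inverse X else X) :
    ((∃ j : Fin n, ∃ hj : j.1 + 1 < n, w j = false ∧ w ⟨j.1 + 1, hj⟩ = false) →
        R n f = 0) ∧
    ((∀ j : Fin n, ∀ hj : j.1 + 1 < n, w j = false → w ⟨j.1 + 1, hj⟩ = true) →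
        (R n f = (-1 : ℂ) ^ (Finset.univ.filter fun i => w i = false).card *
            R ((Finset.univ.filter fun i => w i = true).card)
              (fun _ => Ring.inverse X) ∧
          R n f = (-1 : ℂ) ^ (Finset.univ.filter fun i => w i = false).card *
            ((catalan ((Finset.univ.filter fun i => w i = true).card - 1) : ℂ) /
              ((l : ℂ) - 1) ^ (2 * (Finset.univ.filter fun i => w i = true).card - 1)))) := by
  obtain ⟨n, rfl⟩ := Nat.exists_eq_add_of_le' hn
  obtain rfl : f = fun i => if w i then Ring.inverse X else X := funext hf
  obtain ⟨u, hu⟩ : ∃ u, List.ofFn w = true :: u := ⟨_, by rw [List.ofFn_succ]; congr⟩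
  have hR : R (n + 1) (fun i => if w i then Ring.inverse X else X) =
      wordVal (fun k => (catalan k : ℂ) / ((l : ℂ) - 1) ^ (2 * k + 1)) u := by
    rw [← listCum_inverse_word hst htr hmc hXsa hU hl hmom u, ← hu, List.map_ofFn, listCum_ofFn]
    rfl
  have hadj : NoAdjFalse u ↔ NoAdjFalse (List.ofFn w) := by
    rw [hu, ← List.nil_append (true :: u), noAdjFalse_append_true_cons]
    simp [NoAdjFalse]
  rw [noAdjFalse_ofFn] at hadj
  have hinv := freePoisson_inverse_cumulant hl hst hmc hXsa hXsa.ringInverse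
    (Ring.mul_inverse_cancel X hU) (Ring.inverse_mul_cancel X hU) hmom (u.count true)
  rw [← List.ofFn_const, listCum_ofFn] at hinv
  rw [hR, wordVal]
  constructor
  · rintro ⟨j, hj, hj0, hj1⟩
    refine if_neg fun h => ?_
    simp [hadj.mp h j hj hj0] at hj1
  · intro h
    rw [if_pos (hadj.mpr h), card_filter_eq_count_ofFn, card_filter_eq_count_ofFn, hu,
      List.count_cons_self, List.count_cons_of_ne (by decide), hinv, Nat.add_sub_cancel,
      show 2 * (u.count true + 1) - 1 = 2 * u.count true + 1 by omega]
    exact ⟨rfl, rfl⟩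

end FreeProbLukacs
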